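/- arXiv:1411.6283 — 2 statements merged into one kernel-verified Lean document; each statement's English description precedes it below -/
import Mathlib

section
/- Let n ≥ 5. The dimension of the polytope P_{n,K} (the dimension of the affine span of P_{n,K} in ℝ^{|E|+n−3}) is: (i) |E|+n−4 if K = 2; (ii) |E|+n−3 (i.e., P_{n,K} is full-dimensional) if 3 ≤ K ≤ n−2; (iii) |E|−1 if K = n−1. -/
/-- A `K`-partition of `V = {1,…,n}`: a family of `K` nonempty pairwise disjoint
subsets of `V` (clusters) whose union is `V`. -/
structure KPartition (n K : ℕ) where
  parts : Finset (Finset ℕ)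
  card_parts : parts.card = K
  parts_nonempty : ∀ C ∈ parts, C.Nonempty
  parts_disjoint : ∀ C ∈ parts, ∀ D ∈ parts, C ≠ D → Disjoint C D
  parts_cover : parts.sup id = Finset.Icc 1 n

/-- The ambient space: one (symmetric) edge coordinate for each pair of vertices and one
representative coordinate for each vertex (only the coordinates of edges `uv ∈ E` and of
vertices `v ∈ {4,…,n}` are actually used; the remaining ones are affinely determined, so
affine dimensions agree with those in `ℝ^{|E|+n-3}`). -/
abbrev GPoint : Type := (ℕ × ℕ → ℝ) × (ℕ → ℝ)

open Classical in
/-- The characteristic vector of a `K`-partition: edge component `x_{u,v} = 1` iff `u` and `v`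
lie in the same cluster; representative component `x_v = 1` (for `v ∈ {4,…,n}`) iff `v` is the
smallest element of its cluster. -/
noncomputable def charVec (n K : ℕ) (π : KPartition n K) : GPoint :=
  ⟨fun p => if ∃ C ∈ π.parts, p.1 ∈ C ∧ p.2 ∈ C then 1 else 0,
   fun v => if 4 ≤ v ∧ ∃ C ∈ π.parts, v ∈ C ∧ ∀ w ∈ C, v ≤ w then 1 else 0⟩

/-- `P_{n,K}`: the convex hull of the characteristic vectors of all `K`-partitions. -/
noncomputable def PolyP (n K : ℕ) : Set GPoint :=
  convexHull ℝ {x | ∃ π : KPartition n K, x = charVec n K π}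

/-- Affine dimension of a set: the rank of the direction of its affine span. -/
noncomputable def adim (s : Set GPoint) : ℕ :=
  Module.finrank ℝ (affineSpan ℝ s).direction

/-- `f x ≤ b` is a valid inequality for `P_{n,K}` which is facet-defining. -/
def IsFacetLe (n K : ℕ) (f : GPoint → ℝ) (b : ℝ) : Prop :=
  (∀ x ∈ PolyP n K, f x ≤ b) ∧
  adim {x | x ∈ PolyP n K ∧ f x = b} + 1 = adim (PolyP n K)

/-- `f x ≥ b` is a valid inequality for `P_{n,K}` which is facet-defining. -/
def IsFacetGe (n K : ℕ) (f : GPoint → ℝ) (b : ℝ) : Prop :=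
  (∀ x ∈ PolyP n K, b ≤ f x) ∧
  adim {x | x ∈ PolyP n K ∧ f x = b} + 1 = adim (PolyP n K)

/-- Sum of the edge components of `x` over the edges with both endpoints in `A`. -/
noncomputable def edgeSum (A : Finset ℕ) (x : GPoint) : ℝ :=
  ∑ e ∈ A.offDiag.filter (fun e => e.1 < e.2), x.1 e

open Finset

/-- The edges `uv` of the complete graph on `{1,…,n}`, written as pairs with `u < v`. -/
def edgeFinset (n : ℕ) : Finset (ℕ × ℕ) :=
  (Icc 1 n ×ˢ Icc 1 n).filter fun e => e.1 < e.2

theorem mem_edgeFinset {n : ℕ} {e : ℕ × ℕ} :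
    e ∈ edgeFinset n ↔ 1 ≤ e.1 ∧ e.1 < e.2 ∧ e.2 ≤ n := by
  simp only [edgeFinset, mem_filter, mem_product, mem_Icc]
  omega

theorem card_edgeFinset (n : ℕ) : #(edgeFinset n) = n * (n - 1) / 2 := by
  have hunion : (Icc 1 n).offDiag = edgeFinset n ∪ (edgeFinset n).image Prod.swap := by
    ext ⟨u, v⟩
    simp only [mem_offDiag, mem_union, mem_image, mem_edgeFinset, mem_Icc, Prod.exists,
      Prod.swap_prod_mk, Prod.mk.injEq]
    constructor
    · rintro ⟨hu, hv, huv⟩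
      rcases lt_or_gt_of_ne huv with h | h
      · left; omega
      · right; exact ⟨v, u, by omega, rfl, rfl⟩
    · rintro (h | ⟨a, b, h, rfl, rfl⟩) <;> omega
  have hdisj : Disjoint (edgeFinset n) ((edgeFinset n).image Prod.swap) := by
    rw [disjoint_left]
    rintro ⟨u, v⟩ h h'
    simp only [mem_image, mem_edgeFinset, Prod.exists, Prod.swap_prod_mk, Prod.mk.injEq] at h h'
    obtain ⟨a, b, h', rfl, rfl⟩ := h'
    omega
  have hcard := congrArg card hunion
  rw [card_union_of_disjoint hdisj, card_image_of_injective _ Prod.swap_injective,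
    offDiag_card, Nat.card_Icc, Nat.add_sub_cancel] at hcard
  rw [Nat.mul_sub_one]
  omega

/-- The coordinates of `ℝ^{|E|+n-3}`. -/
abbrev Coord (n : ℕ) : Type := edgeFinset n ⊕ Icc 4 n

theorem card_coord (n : ℕ) : Fintype.card (Coord n) = n * (n - 1) / 2 + (n - 3) := by
  simp only [Fintype.card_sum, Fintype.card_coe, card_edgeFinset, Nat.card_Icc]
  omega

/-- The projection of the ambient space to `ℝ^{|E|+n-3}`. -/
def coordMap (n : ℕ) : GPoint →ₗ[ℝ] (Coord n → ℝ) where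
  toFun x := Sum.elim (fun e => x.1 e) (fun v => x.2 v)
  map_add' x y := by ext (e | v) <;> rfl
  map_smul' c x := by ext (e | v) <;> rfl

theorem adim_PolyP (n K : ℕ) :
    adim (PolyP n K) = Module.finrank ℝ (vectorSpan ℝ (Set.range (charVec n K))) := by
  have h : {x | ∃ π : KPartition n K, x = charVec n K π} = Set.range (charVec n K) := by
    ext x; simp [eq_comm]
  rw [adim, PolyP, affineSpan_convexHull, h, direction_affineSpan]

theorem KPartition.biUnion_parts {n K : ℕ} (π : KPartition n K) :
    π.parts.biUnion id = Icc 1 n := by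
  rw [← sup_eq_biUnion, π.parts_cover]

theorem KPartition.subset_Icc {n K : ℕ} (π : KPartition n K) {C : Finset ℕ} (hC : C ∈ π.parts) :
    C ⊆ Icc 1 n :=
  π.biUnion_parts ▸ subset_biUnion_of_mem id hC

theorem KPartition.exists_mem {n K : ℕ} (π : KPartition n K) {v : ℕ} (hv : v ∈ Icc 1 n) :
    ∃ C ∈ π.parts, v ∈ C := by
  rw [← π.biUnion_parts] at hv
  simpa using hv

theorem KPartition.eq_of_mem {n K : ℕ} (π : KPartition n K) {C D : Finset ℕ} {v : ℕ}
    (hC : C ∈ π.parts) (hD : D ∈ π.parts) (hvC : v ∈ C) (hvD : v ∈ D) : C = D := by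
  by_contra h
  exact disjoint_left.1 (π.parts_disjoint C hC D hD h) hvC hvD

theorem eq_zero_of_coordMap_eq_zero {n K : ℕ} {x : GPoint}
    (hx : x ∈ vectorSpan ℝ (Set.range (charVec n K))) (h : coordMap n x = 0) : x = 0 := by
  have key : (∀ u v, x.1 (u, v) = x.1 (v, u)) ∧ (∀ u, x.1 (u, u) = 0) ∧
      (∀ u v, (u ∉ Icc 1 n ∨ v ∉ Icc 1 n) → x.1 (u, v) = 0) ∧ ∀ v ∉ Icc 4 n, x.2 v = 0 := by
    clear h
    rw [vectorSpan] at hx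
    induction hx using Submodule.span_induction with
    | mem x hx =>
      obtain ⟨_, ⟨π, rfl⟩, _, ⟨π', rfl⟩, rfl⟩ := hx
      have hout : ∀ π : KPartition n K, ∀ u v, (u ∉ Icc 1 n ∨ v ∉ Icc 1 n) →
          (charVec n K π).1 (u, v) = 0 := by
        rintro π u v huv
        refine if_neg ?_
        rintro ⟨C, hC, hu, hv⟩
        exact huv.elim (fun h => h (π.subset_Icc hC hu)) (fun h => h (π.subset_Icc hC hv))
      have hsymm : ∀ π : KPartition n K, ∀ u v,
          (charVec n K π).1 (u, v) = (charVec n K π).1 (v, u) := by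
        intro π u v
        simp only [charVec, and_comm (a := u ∈ _)]
      have hdiag : ∀ π : KPartition n K, ∀ u ∈ Icc 1 n, (charVec n K π).1 (u, u) = 1 := by
        intro π u hu
        obtain ⟨C, hC, h⟩ := π.exists_mem hu
        exact if_pos ⟨C, hC, h, h⟩
      have hrep : ∀ π : KPartition n K, ∀ v ∉ Icc 4 n, (charVec n K π).2 v = 0 := by
        intro π v hv
        refine if_neg ?_
        rintro ⟨h4, C, hC, hvC, -⟩
        have := π.subset_Icc hC hvC
        simp only [mem_Icc] at hv this
        omega
      simp only [vsub_eq_sub, Prod.fst_sub, Prod.snd_sub, Pi.sub_apply]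
      refine ⟨fun u v => by rw [hsymm π u v, hsymm π' u v], fun u => ?_, fun u v huv => ?_,
        fun v hv => ?_⟩
      · by_cases hu : u ∈ Icc 1 n
        · rw [hdiag π u hu, hdiag π' u hu, sub_self]
        · rw [hout π u u (.inl hu), hout π' u u (.inl hu), sub_self]
      · rw [hout π u v huv, hout π' u v huv, sub_self]
      · rw [hrep π v hv, hrep π' v hv, sub_self]
    | zero => simp
    | add x y _ _ hx hy =>
      obtain ⟨h1, h2, h3, h4⟩ := hx
      obtain ⟨k1, k2, k3, k4⟩ := hy
      simp only [Prod.fst_add, Prod.snd_add, Pi.add_apply]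
      exact ⟨fun u v => by rw [h1, k1], fun u => by rw [h2, k2, add_zero],
        fun u v huv => by rw [h3 u v huv, k3 u v huv, add_zero],
        fun v hv => by rw [h4 v hv, k4 v hv, add_zero]⟩
    | smul c x _ hx =>
      obtain ⟨h1, h2, h3, h4⟩ := hx
      simp only [Prod.smul_fst, Prod.smul_snd, Pi.smul_apply, smul_eq_mul]
      exact ⟨fun u v => by rw [h1], fun u => by rw [h2, mul_zero],
        fun u v huv => by rw [h3 u v huv, mul_zero], fun v hv => by rw [h4 v hv, mul_zero]⟩
  obtain ⟨hsymm, hdiag, hout, hrep⟩ := key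
  have hlt : ∀ u v, u < v → x.1 (u, v) = 0 := by
    intro u v huv
    by_cases hmem : (u, v) ∈ edgeFinset n
    · exact congrFun h (.inl ⟨_, hmem⟩)
    · refine hout u v ?_
      rw [mem_edgeFinset] at hmem
      simp only [mem_Icc]
      omega
  ext e
  · obtain ⟨u, v⟩ := e
    rcases lt_trichotomy u v with huv | rfl | huv
    · exact hlt u v huv
    · exact hdiag u
    · rw [hsymm]; exact hlt v u huv
  · by_cases hv : e ∈ Icc 4 n
    · exact congrFun h (.inr ⟨e, hv⟩)
    · exact hrep e hv

/-- The coefficient vectors of the linear forms that are constant on the characteristic vectors of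
`K`-partitions. -/
def constForms (n K : ℕ) : Submodule ℝ (Coord n → ℝ) where
  carrier := {y | ∀ π π' : KPartition n K,
    y ⬝ᵥ coordMap n (charVec n K π) = y ⬝ᵥ coordMap n (charVec n K π')}
  add_mem' h h' π π' := by rw [add_dotProduct, add_dotProduct, h π π', h' π π']
  zero_mem' π π' := by simp
  smul_mem' c y h π π' := by rw [smul_dotProduct, smul_dotProduct, h π π']

theorem adim_PolyP_add_finrank_constForms (n K : ℕ) :
    adim (PolyP n K) + Module.finrank ℝ (constForms n K) = n * (n - 1) / 2 + (n - 3) := by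
  set V := vectorSpan ℝ (Set.range (charVec n K)) with hV
  have hmap : Module.finrank ℝ (V.map (coordMap n)) = Module.finrank ℝ V := by
    rw [← LinearMap.range_domRestrict]
    refine LinearMap.finrank_range_of_inj ((injective_iff_map_eq_zero _).2 ?_)
    rintro ⟨x, hx⟩ h
    exact Subtype.ext (eq_zero_of_coordMap_eq_zero hx h)
  have hdual : (constForms n K).map (dotProductEquiv ℝ (Coord n)).toLinearMap =
      (V.map (coordMap n)).dualAnnihilator := by
    ext φ
    obtain ⟨y, rfl⟩ := (dotProductEquiv ℝ (Coord n)).surjective φ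
    rw [Submodule.mem_dualAnnihilator]
    constructor
    · rintro ⟨z, hz, hzy⟩
      obtain rfl := (dotProductEquiv ℝ (Coord n)).injective hzy
      rintro _ ⟨x, hx, rfl⟩
      rw [SetLike.mem_coe, hV, vectorSpan] at hx
      induction hx using Submodule.span_induction with
      | mem x hx =>
        obtain ⟨_, ⟨π, rfl⟩, _, ⟨π', rfl⟩, rfl⟩ := hx
        beta_reduce
        rw [vsub_eq_sub, map_sub, map_sub, sub_eq_zero]
        exact hz π π'
      | zero => simp
      | add x x' _ _ hx hx' => rw [map_add, map_add, hx, hx', add_zero]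
      | smul c x _ hx => rw [map_smul, map_smul, hx, smul_zero]
    · intro h
      refine ⟨y, fun π π' => ?_, rfl⟩
      have := h _ ⟨_, vsub_mem_vectorSpan ℝ (Set.mem_range_self π) (Set.mem_range_self π'), rfl⟩
      rwa [vsub_eq_sub, map_sub, map_sub, sub_eq_zero] at this
  have hrank := Subspace.finrank_add_finrank_dualAnnihilator_eq (V.map (coordMap n))
  rw [← hdual, LinearEquiv.finrank_map_eq, hmap, Module.finrank_fintype_fun_eq_card,
    card_coord] at hrank
  rw [adim_PolyP, hrank]

/-- The coefficient at `uv` of a linear form, extended by zero to all pairs. -/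
noncomputable def edgeCoeff {n : ℕ} (y : Coord n → ℝ) (u v : ℕ) : ℝ :=
  if h : (u, v) ∈ edgeFinset n then y (.inl ⟨(u, v), h⟩) else 0

/-- The coefficient at `v` of a linear form, extended by zero to all vertices. -/
noncomputable def vertexCoeff {n : ℕ} (y : Coord n → ℝ) (v : ℕ) : ℝ :=
  if h : v ∈ Icc 4 n then y (.inr ⟨v, h⟩) else 0

theorem edgeCoeff_of_le {n : ℕ} (y : Coord n → ℝ) {u v : ℕ} (h : v ≤ u) : edgeCoeff y u v = 0 :=
  dif_neg fun h' => by rw [mem_edgeFinset] at h'; omega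

theorem vertexCoeff_of_lt {n : ℕ} (y : Coord n → ℝ) {v : ℕ} (h : v < 4) : vertexCoeff y v = 0 :=
  dif_neg fun h' => by rw [mem_Icc] at h'; omega

/-- The contribution of the cluster `C` to the value of a linear form. -/
noncomputable def clusterValue (a : ℕ → ℕ → ℝ) (b : ℕ → ℝ) (C : Finset ℕ) : ℝ :=
  ∑ u ∈ C, ∑ v ∈ C, a u v + ∑ v ∈ C, if ∀ w ∈ C, v ≤ w then b v else 0

theorem dotProduct_coordMap {n : ℕ} (y : Coord n → ℝ) (x : GPoint) :
    y ⬝ᵥ coordMap n x =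
      ∑ u ∈ Icc 1 n, ∑ v ∈ Icc 1 n, edgeCoeff y u v * x.1 (u, v) +
        ∑ v ∈ Icc 1 n, vertexCoeff y v * x.2 v := by
  have hedge : ∑ e : edgeFinset n, y (.inl e) * x.1 e =
      ∑ u ∈ Icc 1 n, ∑ v ∈ Icc 1 n, edgeCoeff y u v * x.1 (u, v) := by
    rw [← sum_product' (f := fun u v => edgeCoeff y u v * x.1 (u, v)),
      ← sum_subset (filter_subset (fun e : ℕ × ℕ => e.1 < e.2) _), ← edgeFinset,
      ← sum_coe_sort (edgeFinset n)]
    · refine sum_congr rfl fun e _ => ?_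
      rw [edgeCoeff, dif_pos e.2]
    · intro e _ he
      rw [edgeCoeff, dif_neg (by exact he), zero_mul]
  have hvertex : ∑ v : Icc 4 n, y (.inr v) * x.2 v =
      ∑ v ∈ Icc 1 n, vertexCoeff y v * x.2 v := by
    rw [← sum_subset (Icc_subset_Icc_left (by norm_num : 1 ≤ 4)), ← sum_coe_sort (Icc 4 n)]
    · refine sum_congr rfl fun v _ => ?_
      rw [vertexCoeff, dif_pos v.2]
    · intro v _ hv
      rw [vertexCoeff, dif_neg hv, zero_mul]
  rw [dotProduct, Fintype.sum_sum_type, ← hedge, ← hvertex]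
  rfl

theorem KPartition.sum_Icc {n K : ℕ} (π : KPartition n K) (F : ℕ → ℝ) :
    ∑ v ∈ Icc 1 n, F v = ∑ C ∈ π.parts, ∑ v ∈ C, F v := by
  rw [← π.biUnion_parts, sum_biUnion]
  · rfl
  · exact fun C hC D hD h => π.parts_disjoint C hC D hD h

theorem dotProduct_coordMap_charVec {n K : ℕ} (y : Coord n → ℝ) (π : KPartition n K) :
    y ⬝ᵥ coordMap n (charVec n K π) =
      ∑ C ∈ π.parts, clusterValue (edgeCoeff y) (vertexCoeff y) C := by
  rw [dotProduct_coordMap, π.sum_Icc, π.sum_Icc, ← sum_add_distrib]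
  refine sum_congr rfl fun C hC => ?_
  rw [clusterValue]
  congr 1
  · refine sum_congr rfl fun u hu => ?_
    rw [← sum_subset (π.subset_Icc hC)]
    · refine sum_congr rfl fun v hv => ?_
      rw [show (charVec n K π).1 (u, v) = 1 from if_pos ⟨C, hC, hu, hv⟩, mul_one]
    · intro v _ hv
      rw [show (charVec n K π).1 (u, v) = 0 from if_neg ?_, mul_zero]
      rintro ⟨D, hD, huD, hvD⟩
      rw [π.eq_of_mem hD hC huD hu] at hvD
      exact hv hvD
  · refine sum_congr rfl fun v hv => ?_
    by_cases h4 : 4 ≤ v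
    · have hiff : (4 ≤ v ∧ ∃ D ∈ π.parts, v ∈ D ∧ ∀ w ∈ D, v ≤ w) ↔ ∀ w ∈ C, v ≤ w := by
        constructor
        · rintro ⟨-, D, hD, hvD, h⟩
          rwa [π.eq_of_mem hD hC hvD hv] at h
        · exact fun h => ⟨h4, C, hC, hv, h⟩
      by_cases h : ∀ w ∈ C, v ≤ w
      · rw [if_pos h, show (charVec n K π).2 v = 1 from if_pos (hiff.2 h), mul_one]
      · rw [if_neg h, show (charVec n K π).2 v = 0 from if_neg (mt hiff.1 h), mul_zero]
    · rw [vertexCoeff_of_lt y (by omega)]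
      simp

theorem exists_KPartition_parts_eq_insert {n K : ℕ} {R : Finset ℕ}
    (P : Finpartition R) (hP : #P.parts + 2 = K) {C D : Finset ℕ} (hC : C.Nonempty)
    (hD : D.Nonempty) (hCD : Disjoint C D) (hR : Disjoint (C ∪ D) R)
    (hunion : C ∪ D ∪ R = Icc 1 n) :
    ∃ π : KPartition n K, ∀ g : Finset ℕ → ℝ,
      ∑ B ∈ π.parts, g B = g C + g D + ∑ B ∈ P.parts, g B := by
  rw [disjoint_union_left] at hR
  have hPR : ∀ B ∈ P.parts, B ⊆ R := fun B hB => P.le hB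
  have hne : C ≠ D := fun h => hC.ne_empty (disjoint_self.1 (h ▸ hCD))
  have hCP : C ∉ P.parts := fun h => hC.ne_empty (disjoint_self.1 (hR.1.mono_right (hPR C h)))
  have hDP : D ∉ P.parts := fun h => hD.ne_empty (disjoint_self.1 (hR.2.mono_right (hPR D h)))
  have hCDP : C ∉ insert D P.parts := by simp [hne, hCP]
  refine ⟨⟨insert C (insert D P.parts), ?_, ?_, ?_, ?_⟩, fun g => ?_⟩
  · rw [card_insert_of_notMem hCDP, card_insert_of_notMem hDP, ← hP]
  · intro B hB
    rw [mem_insert, mem_insert] at hB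
    rcases hB with rfl | rfl | hB
    exacts [hC, hD, P.nonempty_of_mem_parts hB]
  · intro A hA B hB hAB
    rw [mem_insert, mem_insert] at hA hB
    rcases hA with rfl | rfl | hA <;> rcases hB with rfl | rfl | hB
    exacts [absurd rfl hAB, hCD, hR.1.mono_right (hPR B hB), hCD.symm, absurd rfl hAB,
      hR.2.mono_right (hPR B hB), (hR.1.mono_right (hPR A hA)).symm,
      (hR.2.mono_right (hPR A hA)).symm, P.disjoint hA hB hAB]
  · rw [sup_insert, sup_insert, P.sup_parts, ← hunion, union_assoc]
    rfl
  · rw [sum_insert hCDP, sum_insert hDP, add_assoc]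

theorem clusterValue_singleton {n : ℕ} (y : Coord n → ℝ) (v : ℕ) :
    clusterValue (edgeCoeff y) (vertexCoeff y) {v} = vertexCoeff y v := by
  simp [clusterValue, edgeCoeff_of_le]

theorem clusterValue_pair {n : ℕ} (y : Coord n → ℝ) {u v : ℕ} (huv : u < v) :
    clusterValue (edgeCoeff y) (vertexCoeff y) {u, v} = edgeCoeff y u v + vertexCoeff y u := by
  simp [clusterValue, edgeCoeff_of_le, huv.le, huv.not_ge, sum_pair huv.ne]

theorem clusterValue_triple {n : ℕ} (y : Coord n → ℝ) {u v w : ℕ} (huv : u < v) (hvw : v < w) :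
    clusterValue (edgeCoeff y) (vertexCoeff y) {u, v, w} =
      edgeCoeff y u v + edgeCoeff y u w + edgeCoeff y v w + vertexCoeff y u := by
  have huw := huv.trans hvw
  have hu : u ∉ ({v, w} : Finset ℕ) := by simp; omega
  simp only [clusterValue, sum_insert hu, sum_pair hvw.ne]
  simp [edgeCoeff_of_le, huv.le, huv.not_ge, hvw.le, huw.le, huw.not_ge]

theorem clusterValue_add_eq_of_union_eq {n K : ℕ} (hK : 3 ≤ K) {y : Coord n → ℝ}
    (hy : y ∈ constForms n K) {C D C' D' : Finset ℕ} (hC : C.Nonempty) (hD : D.Nonempty)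
    (hCD : Disjoint C D) (hC' : C'.Nonempty) (hD' : D'.Nonempty) (hCD' : Disjoint C' D')
    (hunion : C ∪ D = C' ∪ D') (hsub : C ∪ D ⊆ Icc 1 n) (hcard : #(C ∪ D) + K ≤ n + 2) :
    clusterValue (edgeCoeff y) (vertexCoeff y) C + clusterValue (edgeCoeff y) (vertexCoeff y) D =
      clusterValue (edgeCoeff y) (vertexCoeff y) C' +
        clusterValue (edgeCoeff y) (vertexCoeff y) D' := by
  obtain ⟨P, -, hP⟩ := Finpartition.exists_equipartition_card_eq (Icc 1 n \ (C ∪ D))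
    (n := K - 2) (by omega) (by rw [card_sdiff_of_subset hsub, Nat.card_Icc]; omega)
  have hR := union_sdiff_of_subset hsub
  obtain ⟨π, hπ⟩ := exists_KPartition_parts_eq_insert P (by omega : _ + 2 = K) hC hD hCD
    disjoint_sdiff hR
  obtain ⟨π', hπ'⟩ := exists_KPartition_parts_eq_insert P (by omega : _ + 2 = K) hC' hD' hCD'
    (hunion ▸ disjoint_sdiff) (by rw [← hunion, hR])
  have h := hy π π'
  rw [dotProduct_coordMap_charVec, dotProduct_coordMap_charVec, hπ, hπ'] at h
  exact add_right_cancel h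

theorem eq_of_coeff_eq {n : ℕ} {y z : Coord n → ℝ}
    (hedge : ∀ u v, 1 ≤ u → u < v → v ≤ n → edgeCoeff y u v = edgeCoeff z u v)
    (hvertex : ∀ v, 4 ≤ v → v ≤ n → vertexCoeff y v = vertexCoeff z v) : y = z := by
  ext (⟨⟨u, v⟩, he⟩ | ⟨v, hv⟩)
  · have h := mem_edgeFinset.1 he
    simpa only [edgeCoeff, dif_pos he] using hedge u v h.1 h.2.1 h.2.2
  · have h := mem_Icc.1 hv
    simpa only [vertexCoeff, dif_pos hv] using hvertex v h.1 h.2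

theorem constForms_eq_bot {n K : ℕ} (hn : 5 ≤ n) (hK : 3 ≤ K) (hKn : K ≤ n - 2) :
    constForms n K = ⊥ := by
  rw [eq_bot_iff]
  intro y hy
  set g := clusterValue (edgeCoeff y) (vertexCoeff y) with hg
  have hswap : ∀ u v w, u ∈ Icc 1 n → v ∈ Icc 1 n → w ∈ Icc 1 n → u ≠ v → u ≠ w → v ≠ w →
      g {u, v} + g {w} = g {v, w} + g {u} := by
    intro u v w hu hv hw huv huw hvw
    refine clusterValue_add_eq_of_union_eq hK hy (by simp) (by simp) ?_ (by simp) (by simp) ?_ ?_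
      ?_ ?_
    · simp; omega
    · simp; omega
    · ext x; simp; tauto
    · intro x; simp only [mem_union, mem_insert, mem_singleton]; rintro ((rfl | rfl) | rfl) <;>
        assumption
    · have : #(({u, v} : Finset ℕ) ∪ {w}) ≤ 3 :=
        (card_union_le _ _).trans (Nat.add_le_add card_le_two (card_singleton w).le)
      omega
  have hswap' : ∀ u v w x, u ∈ Icc 1 n → v ∈ Icc 1 n → w ∈ Icc 1 n → x ∈ Icc 1 n → u ≠ v →
      u ≠ w → v ≠ w → u ≠ x → v ≠ x → w ≠ x → g {u, v, w} + g {x} = g {u, v} + g {w, x} := by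
    intro u v w x hu hv hw hx huv huw hvw hux hvx hwx
    refine clusterValue_add_eq_of_union_eq hK hy (by simp) (by simp) ?_ (by simp) (by simp) ?_ ?_
      ?_ ?_
    · simp; omega
    · simp; omega
    · ext z; simp; tauto
    · intro z; simp only [mem_union, mem_insert, mem_singleton]
      rintro ((rfl | rfl | rfl) | rfl) <;> assumption
    · have : #(({u, v, w} : Finset ℕ) ∪ {x}) ≤ 4 :=
        (card_union_le _ _).trans (Nat.add_le_add card_le_three (card_singleton x).le)
      omega
  obtain ⟨h, hh⟩ : ∃ h, ∀ u v, 1 ≤ u → u < v → v ≤ n →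
      g {u, v} = h + vertexCoeff y u + vertexCoeff y v := by
    have hpair : ∀ u v, g {u, v} = g {v, u} := fun u v => by rw [pair_comm]
    refine ⟨g {1, 2} - vertexCoeff y 1 - vertexCoeff y 2, fun u v hu huv hv => ?_⟩
    have hone : ∀ v, 2 ≤ v → v ≤ n → g {1, v} =
        g {1, 2} - vertexCoeff y 1 - vertexCoeff y 2 + vertexCoeff y 1 + vertexCoeff y v := by
      intro v h2 hv
      rcases eq_or_ne v 2 with rfl | hne
      · ring
      · have := hswap v 1 2 (by simp; omega) (by simp; omega) (by simp; omega) (by omega) hne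
          (by norm_num)
        rw [hg, clusterValue_singleton, clusterValue_singleton, ← hg, hpair v 1] at this
        linarith
    rcases eq_or_ne u 1 with rfl | hne
    · exact hone v huv hv
    · have := hswap u v 1 (by simp; omega) (by simp; omega) (by simp; omega) (by omega) hne
        (by omega)
      rw [hg, clusterValue_singleton, clusterValue_singleton, ← hg, hpair v 1,
        hone v (by omega) hv] at this
      linarith
  have hedge : ∀ u v, 1 ≤ u → u < v → v ≤ n → edgeCoeff y u v = h + vertexCoeff y v := by
    intro u v hu huv hv
    have := hh u v hu huv hv
    rw [hg, clusterValue_pair y huv] at this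
    linarith
  have hvertex : ∀ v x, 3 ≤ v → v ≤ n → 3 ≤ x → x ≤ n → v ≠ x → h + vertexCoeff y v = 0 := by
    intro v x h3 hv hx3 hx hvx
    have htriple := hswap' 1 2 v x (by simp; omega) (by simp; omega) (by simp; omega)
      (by simp; omega) (by omega) (by omega) (by omega) (by omega) (by omega) hvx
    have hvx' : g {v, x} = h + vertexCoeff y v + vertexCoeff y x := by
      rcases lt_or_gt_of_ne hvx with hlt | hlt
      · exact hh v x (by omega) hlt hx
      · rw [pair_comm, hh x v (by omega) hlt hv]; ring
    rw [hvx', hg, clusterValue_triple y one_lt_two (by omega), clusterValue_singleton,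
      clusterValue_pair y one_lt_two, hedge 1 v le_rfl (by omega) hv,
      hedge 2 v (by omega) (by omega) hv] at htriple
    linarith
  have hzero : h = 0 := by
    have := hvertex 3 4 le_rfl (by omega) (by omega) (by omega) (by omega)
    rwa [vertexCoeff_of_lt y (by norm_num), add_zero] at this
  have hb : ∀ v, vertexCoeff y v = 0 := by
    intro v
    by_cases hv : v ∈ Icc 4 n
    · rw [mem_Icc] at hv
      have := hvertex v 3 (by omega) hv.2 le_rfl (by omega) (by omega)
      rwa [hzero, zero_add] at this
    · exact dif_neg hv
  rw [Submodule.mem_bot]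
  refine eq_of_coeff_eq (fun u v hu huv hv => ?_) fun v _ _ => ?_
  · rw [hedge u v hu huv hv, hzero, hb]
    simp [edgeCoeff]
  · rw [hb]
    simp [vertexCoeff]

theorem clusterValue_of_one_mem {n : ℕ} (y : Coord n → ℝ) {C : Finset ℕ} (hC : 1 ∈ C) :
    clusterValue (edgeCoeff y) (vertexCoeff y) C = ∑ u ∈ C, ∑ v ∈ C, edgeCoeff y u v := by
  rw [clusterValue, add_eq_left]
  refine sum_eq_zero fun v _ => ?_
  split_ifs with h
  · exact vertexCoeff_of_lt y ((h 1 hC).trans_lt (by norm_num))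
  · rfl

theorem exists_clusterValue_eq_of_mem_constForms_two {n : ℕ} (hn : 5 ≤ n) {y : Coord n → ℝ}
    (hy : y ∈ constForms n 2) :
    ∃ m : ℝ, ∀ C ⊆ Icc 2 n, C.Nonempty →
      m + clusterValue (edgeCoeff y) (vertexCoeff y) C + ∑ u ∈ C, ∑ v ∈ C, edgeCoeff y u v =
        ∑ u ∈ C, ∑ v ∈ Icc 1 n, (edgeCoeff y u v + edgeCoeff y v u) := by
  have hone : ∀ C ⊆ Icc 2 n, 1 ∈ Icc 1 n \ C := fun C hC =>
    mem_sdiff.2 ⟨by simp; omega, fun h => by simpa using hC h⟩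
  have hC : ∀ C ⊆ Icc 2 n, C.Nonempty → ∃ π : KPartition n 2,
      y ⬝ᵥ coordMap n (charVec n 2 π) = clusterValue (edgeCoeff y) (vertexCoeff y) C +
        clusterValue (edgeCoeff y) (vertexCoeff y) (Icc 1 n \ C) := by
    intro C hCsub hC
    have hsub : C ⊆ Icc 1 n := hCsub.trans (Icc_subset_Icc_left (by norm_num))
    obtain ⟨π, hπ⟩ := exists_KPartition_parts_eq_insert (n := n) (K := 2)
      (Finpartition.empty (Finset ℕ)) rfl hC
      ⟨1, hone C hCsub⟩ disjoint_sdiff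
      (disjoint_empty_right _) (by rw [union_sdiff_of_subset hsub]; exact union_empty _)
    refine ⟨π, ?_⟩
    rw [dotProduct_coordMap_charVec, hπ]
    exact add_zero _
  obtain ⟨π₀, -⟩ := hC {2} (by simp; omega) (by simp)
  refine ⟨∑ u ∈ Icc 1 n, ∑ v ∈ Icc 1 n, edgeCoeff y u v - y ⬝ᵥ coordMap n (charVec n 2 π₀),
    fun C hCsub hCne => ?_⟩
  have hsub : C ⊆ Icc 1 n := hCsub.trans (Icc_subset_Icc_left (by norm_num))
  obtain ⟨π, hπ⟩ := hC C hCsub hCne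
  rw [hy π₀ π, hπ]
  rw [clusterValue_of_one_mem y (hone C hCsub)]
  have hrow : ∀ u, ∑ v ∈ Icc 1 n \ C, edgeCoeff y u v + ∑ v ∈ C, edgeCoeff y u v =
      ∑ v ∈ Icc 1 n, edgeCoeff y u v := fun u => sum_sdiff hsub
  have h1 := sum_sdiff hsub (f := fun u => ∑ v ∈ Icc 1 n, edgeCoeff y u v)
  have h2 := sum_sdiff hsub (f := fun u => ∑ v ∈ C, edgeCoeff y u v)
  have h3 := sum_congr (rfl : Icc 1 n \ C = _) fun u _ => hrow u
  have h4 := sum_comm (s := C) (t := Icc 1 n) (f := fun u v => edgeCoeff y v u)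
  simp only [sum_add_distrib] at h1 h2 h3 h4 ⊢
  linarith

theorem coeff_of_mem_constForms_two {n : ℕ} (hn : 5 ≤ n) {y : Coord n → ℝ}
    (hy : y ∈ constForms n 2) :
    ∃ m : ℝ, (∀ u v, 1 ≤ u → u < v → v ≤ n → edgeCoeff y u v = if v ≤ 3 then m else 0) ∧
      ∀ v, 4 ≤ v → v ≤ n → vertexCoeff y v = -2 * m := by
  obtain ⟨m, hm⟩ := exists_clusterValue_eq_of_mem_constForms_two hn hy
  set d : ℕ → ℝ := fun u => ∑ v ∈ Icc 1 n, (edgeCoeff y u v + edgeCoeff y v u) with hd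
  have hd1 : ∀ v, 2 ≤ v → v ≤ n → d v = m + vertexCoeff y v := by
    intro v h2 hv
    have := hm {v} (by simp; omega) (by simp)
    rw [clusterValue_singleton] at this
    simp only [sum_singleton, edgeCoeff_of_le y le_rfl (u := v)] at this
    linarith
  have hd2 : ∀ u v, 2 ≤ u → u < v → v ≤ n → 2 * edgeCoeff y u v = m + vertexCoeff y v := by
    intro u v h2 huv hv
    have := hm {u, v} (by intro x; simp; omega) (by simp)
    rw [clusterValue_pair y huv] at this
    simp only [sum_pair huv.ne, edgeCoeff_of_le y le_rfl, edgeCoeff_of_le y huv.le] at this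
    have h1 := hd1 u h2 (by omega)
    have h1' := hd1 v (by omega) hv
    simp only [hd] at h1 h1'
    linarith
  have hb : ∀ w, 4 ≤ w → w ≤ n → vertexCoeff y w = -m := by
    intro w h4 hw
    have := hm {2, 3, w} (by intro x; simp; omega) (by simp)
    rw [clusterValue_triple y (by norm_num) (by omega)] at this
    have h2 : 2 ∉ ({3, w} : Finset ℕ) := by simp; omega
    simp only [sum_insert h2, sum_pair (show 3 ≠ w by omega), edgeCoeff_of_le y le_rfl,
      edgeCoeff_of_le y (show 2 ≤ 3 by norm_num), edgeCoeff_of_le y (show 2 ≤ w by omega),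
      edgeCoeff_of_le y (show 3 ≤ w by omega)] at this
    have k2 := hd1 2 le_rfl (by omega)
    have k3 := hd1 3 (by norm_num) (by omega)
    have kw := hd1 w (by omega) hw
    have l1 := hd2 2 3 le_rfl (by norm_num) (by omega)
    have l2 := hd2 2 w le_rfl (by omega) hw
    have l3 := hd2 3 w (by norm_num) (by omega) hw
    simp only [hd] at k2 k3 kw
    linarith
  have ha : ∀ u v, 2 ≤ u → u < v → 4 ≤ v → v ≤ n → edgeCoeff y u v = 0 := by
    intro u v hu huv h4 hv
    have := hd2 u v hu huv hv
    rw [hb v h4 hv] at this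
    linarith
  have ha23 : 2 * edgeCoeff y 2 3 = m := by
    rw [hd2 2 3 le_rfl (by norm_num) (by omega), vertexCoeff_of_lt y (by norm_num), add_zero]
  have hone : ∀ u, 4 ≤ u → u ≤ n → edgeCoeff y 1 u = 0 := by
    intro u h4 hu
    have h := hd1 u (by omega) hu
    rw [hb u h4 hu, add_neg_cancel, hd] at h
    dsimp only at h
    rw [sum_eq_single 1, edgeCoeff_of_le y (show 1 ≤ u by omega), zero_add] at h
    · exact h
    · intro v hv hv1
      rw [mem_Icc] at hv
      rcases lt_trichotomy u v with huv | rfl | huv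
      · rw [ha u v (by omega) huv (by omega) hv.2, edgeCoeff_of_le y huv.le, add_zero]
      · rw [edgeCoeff_of_le y le_rfl, add_zero]
      · rw [ha v u (by omega) huv h4 hu, edgeCoeff_of_le y huv.le, add_zero]
    · intro h1; exact absurd (mem_Icc.2 ⟨le_rfl, by omega⟩) h1
  have hsmall : ∀ u, 2 ≤ u → u ≤ 3 →
      ∑ v ∈ ({1, 2, 3} : Finset ℕ), (edgeCoeff y u v + edgeCoeff y v u) = m := by
    intro u h2 h3
    have h := hd1 u h2 (by omega)
    rw [vertexCoeff_of_lt y (by omega), add_zero, hd] at h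
    rw [← h]
    refine sum_subset (by intro x; simp; omega) fun v hv hv' => ?_
    have hv4 : 4 ≤ v := by simp at hv hv'; omega
    rw [mem_Icc] at hv
    rw [ha u v h2 (by omega) hv4 hv.2, edgeCoeff_of_le y (by omega), add_zero]
  have ha12 := hsmall 2 le_rfl (by norm_num)
  have ha13 := hsmall 3 (by norm_num) le_rfl
  simp [edgeCoeff_of_le] at ha12 ha13
  refine ⟨m / 2, fun u v hu huv hv => ?_, fun v h4 hv => by rw [hb v h4 hv]; ring⟩
  split_ifs with h3
  · have : u = 1 ∧ v = 2 ∨ u = 1 ∧ v = 3 ∨ u = 2 ∧ v = 3 := by omega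
    rcases this with ⟨rfl, rfl⟩ | ⟨rfl, rfl⟩ | ⟨rfl, rfl⟩ <;> linarith
  · rcases eq_or_ne u 1 with rfl | hne
    · exact hone v (by omega) hv
    · exact ha u v (by omega) huv (by omega) hv

/-- The coefficients of `x₁₂ + x₁₃ + x₂₃ - 2 ∑ᵥ xᵥ`, which equals `1` on all `2`-partitions. -/
def triangleForm (n : ℕ) : Coord n → ℝ :=
  Sum.elim (fun e => if e.1.2 ≤ 3 then 1 else 0) fun _ => -2

theorem edgeCoeff_triangleForm {n u v : ℕ} (hu : 1 ≤ u) (huv : u < v) (hv : v ≤ n) :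
    edgeCoeff (triangleForm n) u v = if v ≤ 3 then 1 else 0 := by
  rw [edgeCoeff, dif_pos (mem_edgeFinset.2 ⟨hu, huv, hv⟩)]
  rfl

theorem edgeCoeff_triangleForm_of_three_lt {n u v : ℕ} (hv : 3 < v) :
    edgeCoeff (triangleForm n) u v = 0 := by
  rw [edgeCoeff]
  split_ifs
  · exact if_neg (by simpa using hv)
  · rfl

theorem vertexCoeff_triangleForm {n v : ℕ} (h4 : 4 ≤ v) (hv : v ≤ n) :
    vertexCoeff (triangleForm n) v = -2 := by
  rw [vertexCoeff, dif_pos (mem_Icc.2 ⟨h4, hv⟩)]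
  rfl

theorem sum_eq_of_forall_three_lt {C : Finset ℕ} (h0 : 0 ∉ C) {F : ℕ → ℝ}
    (hF : ∀ u ∈ C, 3 < u → F u = 0) :
    ∑ u ∈ C, F u =
      (if 1 ∈ C then F 1 else 0) + (if 2 ∈ C then F 2 else 0) + if 3 ∈ C then F 3 else 0 := by
  have h : ∑ u ∈ C, F u = ∑ u ∈ ({1, 2, 3} : Finset ℕ), if u ∈ C then F u else 0 := by
    rw [sum_ite_mem, inter_comm]
    refine (sum_subset inter_subset_left fun u hu hu' => hF u hu ?_).symm
    have : u ≠ 0 := fun h => h0 (h ▸ hu)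
    simp [hu] at hu'
    omega
  rw [h, sum_insert (by norm_num), sum_pair (by norm_num), add_assoc]

theorem clusterValue_eq_add_min' (a : ℕ → ℕ → ℝ) (b : ℕ → ℝ) {C : Finset ℕ} (hC : C.Nonempty) :
    clusterValue a b C = ∑ u ∈ C, ∑ v ∈ C, a u v + b (C.min' hC) := by
  rw [clusterValue, add_right_inj, sum_eq_single (C.min' hC)]
  · exact if_pos fun w hw => min'_le C w hw
  · intro v hv hne
    exact if_neg fun h => hne (le_antisymm (h _ (min'_mem C hC)) (min'_le C v hv))
  · exact fun h => absurd (min'_mem C hC) h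

theorem clusterValue_triangleForm {n : ℕ} (hn : 5 ≤ n) {C : Finset ℕ} (hC : C.Nonempty)
    (hsub : C ⊆ Icc 1 n) :
    clusterValue (edgeCoeff (triangleForm n)) (vertexCoeff (triangleForm n)) C =
      (if 1 ∈ C ∧ 2 ∈ C then 1 else 0) + (if 1 ∈ C ∧ 3 ∈ C then 1 else 0) +
        (if 2 ∈ C ∧ 3 ∈ C then 1 else 0) + if 1 ∉ C ∧ 2 ∉ C ∧ 3 ∉ C then -2 else 0 := by
  have h0 : 0 ∉ C := fun h => by simpa using hsub h
  have hmin : vertexCoeff (triangleForm n) (C.min' hC) =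
      if 1 ∉ C ∧ 2 ∉ C ∧ 3 ∉ C then -2 else 0 := by
    split_ifs with h
    · refine vertexCoeff_triangleForm ?_ (mem_Icc.1 (hsub (min'_mem C hC))).2
      have hmem := min'_mem C hC
      by_contra! hlt
      interval_cases C.min' hC <;> simp_all
    · refine vertexCoeff_of_lt _ ?_
      have hle : ∀ v ∈ C, C.min' hC ≤ v := fun v hv => min'_le C v hv
      by_contra! h4
      exact h ⟨fun h => by have := hle 1 h; omega, fun h => by have := hle 2 h; omega,
        fun h => by have := hle 3 h; omega⟩
  have h12 := edgeCoeff_triangleForm (n := n) le_rfl (show 1 < 2 by norm_num) (by omega)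
  have h13 := edgeCoeff_triangleForm (n := n) le_rfl (show 1 < 3 by norm_num) (by omega)
  have h23 := edgeCoeff_triangleForm (n := n) one_le_two (show 2 < 3 by norm_num) (by omega)
  rw [clusterValue_eq_add_min' _ _ hC, hmin, sum_eq_of_forall_three_lt h0]
  · congr 1
    rw [sum_eq_of_forall_three_lt h0, sum_eq_of_forall_three_lt h0, sum_eq_of_forall_three_lt h0]
    · by_cases h1 : 1 ∈ C <;> by_cases h2 : 2 ∈ C <;> by_cases h3 : 3 ∈ C <;>
        simp [h1, h2, h3, h12, h13, h23, edgeCoeff_of_le]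
    all_goals exact fun v _ hv => edgeCoeff_triangleForm_of_three_lt hv
  · intro u _ hu
    refine sum_eq_zero fun v _ => ?_
    rcases le_or_gt v u with h | h
    · exact edgeCoeff_of_le _ h
    · exact edgeCoeff_triangleForm_of_three_lt (hu.trans h)

theorem finrank_constForms_two {n : ℕ} (hn : 5 ≤ n) : Module.finrank ℝ (constForms n 2) = 1 := by
  have hmem : triangleForm n ∈ constForms n 2 := by
    have hone : ∀ π : KPartition n 2, triangleForm n ⬝ᵥ coordMap n (charVec n 2 π) = 1 := by
      intro π
      obtain ⟨C, D, hne, hparts⟩ := card_eq_two.1 π.card_parts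
      have hC : C ∈ π.parts := by simp [hparts]
      have hD : D ∈ π.parts := by simp [hparts]
      have hiff : ∀ v ∈ Icc 1 n, (v ∈ D ↔ v ∉ C) := by
        intro v hv
        refine ⟨fun hvD hvC => hne (π.eq_of_mem hC hD hvC hvD), fun hvC => ?_⟩
        obtain ⟨B, hB, hvB⟩ := π.exists_mem hv
        rw [hparts, mem_insert, mem_singleton] at hB
        rcases hB with rfl | rfl
        exacts [absurd hvB hvC, hvB]
      rw [dotProduct_coordMap_charVec, hparts, sum_pair hne,
        clusterValue_triangleForm hn (π.parts_nonempty C hC) (π.subset_Icc hC),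
        clusterValue_triangleForm hn (π.parts_nonempty D hD) (π.subset_Icc hD)]
      simp only [hiff 1 (by simp; omega), hiff 2 (by simp; omega), hiff 3 (by simp; omega)]
      by_cases h1 : 1 ∈ C <;> by_cases h2 : 2 ∈ C <;> by_cases h3 : 3 ∈ C <;>
        norm_num [h1, h2, h3]
    exact fun π π' => by rw [hone π, hone π']
  refine finrank_eq_one ⟨triangleForm n, hmem⟩ (fun h => ?_) fun ⟨y, hy⟩ => ?_
  · have h4 : 4 ∈ Icc 4 n := by simp; omega
    have := congrFun (congrArg Subtype.val h) (.inr ⟨4, h4⟩)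
    norm_num [triangleForm] at this
  · obtain ⟨m, ha, hb⟩ := coeff_of_mem_constForms_two hn hy
    refine ⟨m, Subtype.ext ?_⟩
    ext (⟨⟨u, v⟩, he⟩ | ⟨v, hv⟩)
    · have h := mem_edgeFinset.1 he
      have := ha u v h.1 h.2.1 h.2.2
      rw [edgeCoeff, dif_pos he] at this
      simp [triangleForm, this]
    · have h := mem_Icc.1 hv
      have := hb v h.1 h.2
      rw [vertexCoeff, dif_pos hv] at this
      simp [triangleForm, this, mul_comm]

/-- The `(n-1)`-partition whose only cluster with two elements is the edge `e`. -/
def pairPartition (n : ℕ) (e : edgeFinset n) : KPartition n (n - 1) where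
  parts := insert {e.1.1, e.1.2} ((Icc 1 n \ {e.1.1, e.1.2}).image singleton)
  card_parts := by
    obtain ⟨⟨u, v⟩, he⟩ := e
    have h := mem_edgeFinset.1 he
    dsimp only at h ⊢
    rw [card_insert_of_notMem, card_image_of_injective _ singleton_injective,
      card_sdiff_of_subset (by intro x; simp; omega), card_pair (by omega), Nat.card_Icc]
    · omega
    · simp only [mem_image, not_exists, not_and]
      intro w _ h'
      have := congrArg card h'
      rw [card_singleton, card_pair (by omega)] at this
      omega
  parts_nonempty C hC := by
    simp only [mem_insert, mem_image] at hC
    rcases hC with rfl | ⟨w, -, rfl⟩ <;> simp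
  parts_disjoint C hC D hD hne := by
    simp only [mem_insert, mem_image, mem_sdiff, mem_singleton] at hC hD
    rcases hC with rfl | ⟨w, hw, rfl⟩ <;> rcases hD with rfl | ⟨x, hx, rfl⟩
    · exact absurd rfl hne
    · simpa [eq_comm] using hx.2
    · simpa using hw.2
    · simpa using hne
  parts_cover := by
    have h := mem_edgeFinset.1 e.2
    rw [sup_insert, sup_image, Function.id_comp, sup_singleton_eq_self]
    exact union_sdiff_of_subset (by intro x; simp; omega)

theorem exists_charVec_eq_pairPartition {n : ℕ} (hn : 2 ≤ n) (π : KPartition n (n - 1)) :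
    ∃ e, charVec n (n - 1) (pairPartition n e) = charVec n (n - 1) π := by
  have hpos : ∀ C ∈ π.parts, 1 ≤ #C := fun C hC => card_pos.2 (π.parts_nonempty C hC)
  have hsum : ∑ C ∈ π.parts, #C = n := by
    have := card_biUnion (s := π.parts) (t := id) π.parts_disjoint
    rw [π.biUnion_parts, Nat.card_Icc] at this
    exact this.symm
  have hsum' : ∑ C ∈ π.parts, (#C - 1) = 1 := by
    rw [sum_tsub_distrib _ hpos, hsum, sum_const, π.card_parts]
    simp
    omega
  obtain ⟨C, hC, hCcard, hrest⟩ : ∃ C ∈ π.parts, #C = 2 ∧ ∀ D ∈ π.parts, D ≠ C → #D = 1 := by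
    obtain ⟨C, hC, hne⟩ := exists_ne_zero_of_sum_ne_zero (hsum'.trans_ne one_ne_zero)
    have h := add_sum_erase π.parts (fun C => #C - 1) hC
    refine ⟨C, hC, by omega, fun D hD hDC => ?_⟩
    have := single_le_sum (f := fun C => #C - 1) (fun _ _ => Nat.zero_le _)
      (mem_erase.2 ⟨hDC, hD⟩)
    have := hpos D hD
    omega
  obtain ⟨u, v, huv, rfl⟩ : ∃ u v, u < v ∧ C = {u, v} := by
    obtain ⟨u, v, hne, rfl⟩ := card_eq_two.1 hCcard
    rcases lt_or_gt_of_ne hne with h | h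
    exacts [⟨u, v, h, rfl⟩, ⟨v, u, h, pair_comm u v⟩]
  have hu := mem_Icc.1 (π.subset_Icc hC (mem_insert_self u {v}))
  have hv := mem_Icc.1 (π.subset_Icc hC (mem_insert_of_mem (mem_singleton_self v)))
  refine ⟨⟨(u, v), mem_edgeFinset.2 ⟨hu.1, huv, hv.2⟩⟩, ?_⟩
  have hparts : (pairPartition n ⟨(u, v), mem_edgeFinset.2 ⟨hu.1, huv, hv.2⟩⟩).parts =
      π.parts := by
    ext D
    simp only [pairPartition, mem_insert, mem_image, mem_sdiff]
    constructor
    · rintro (rfl | ⟨w, ⟨hw, hwuv⟩, rfl⟩)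
      · exact hC
      · obtain ⟨D, hD, hwD⟩ := π.exists_mem hw
        obtain ⟨x, rfl⟩ := card_eq_one.1 (hrest D hD fun h => hwuv (by simpa [h] using hwD))
        rwa [mem_singleton.1 hwD]
    · intro hD
      by_cases hDC : D = {u, v}
      · exact .inl hDC
      · obtain ⟨w, rfl⟩ := card_eq_one.1 (hrest D hD hDC)
        refine .inr ⟨w, ⟨π.subset_Icc hD (mem_singleton_self w), fun hw => hDC ?_⟩, rfl⟩
        exact π.eq_of_mem hD hC (mem_singleton_self w) (by simpa using hw)
  simp only [charVec, hparts]

theorem charVec_pairPartition_fst {n : ℕ} (e e' : edgeFinset n) :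
    (charVec n (n - 1) (pairPartition n e)).1 e' = if e' = e then 1 else 0 := by
  have h := mem_edgeFinset.1 e.2
  have h' := mem_edgeFinset.1 e'.2
  refine if_congr ⟨?_, ?_⟩ rfl rfl
  · rintro ⟨C, hC, h1, h2⟩
    simp only [pairPartition, mem_insert, mem_image] at hC
    rcases hC with rfl | ⟨w, -, rfl⟩
    · simp only [mem_insert, mem_singleton] at h1 h2
      exact Subtype.ext (Prod.ext (by omega) (by omega))
    · simp only [mem_singleton] at h1 h2
      omega
  · rintro rfl
    exact ⟨_, mem_insert_self _ _, by simp, by simp⟩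

theorem adim_PolyP_sub_one {n : ℕ} (hn : 2 ≤ n) :
    adim (PolyP n (n - 1)) = n * (n - 1) / 2 - 1 := by
  have hrange : Set.range (charVec n (n - 1)) =
      Set.range fun e => charVec n (n - 1) (pairPartition n e) := by
    ext x
    constructor
    · rintro ⟨π, rfl⟩
      exact exists_charVec_eq_pairPartition hn π
    · rintro ⟨e, rfl⟩
      exact ⟨_, rfl⟩
  let f : GPoint →ₗ[ℝ] (edgeFinset n → ℝ) :=
    LinearMap.pi fun e => LinearMap.proj e.1 ∘ₗ LinearMap.fst ℝ (ℕ × ℕ → ℝ) (ℕ → ℝ)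
  have hind : LinearIndependent ℝ fun e => charVec n (n - 1) (pairPartition n e) := by
    refine .of_comp f ?_
    have hf : f ∘ (fun e => charVec n (n - 1) (pairPartition n e)) = fun e => Pi.single e 1 := by
      ext e e'
      rw [Pi.single_apply]
      exact charVec_pairPartition_fst e e'
    rw [hf]
    exact Pi.linearIndependent_single_one _ _
  have hcard : Fintype.card (edgeFinset n) = n * (n - 1) / 2 - 1 + 1 := by
    have : 0 < #(edgeFinset n) := card_pos.2 ⟨(1, 2), mem_edgeFinset.2 ⟨le_rfl, one_lt_two, hn⟩⟩
    rw [card_edgeFinset] at this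
    rw [Fintype.card_coe, card_edgeFinset]
    omega
  rw [adim_PolyP, hrange]
  exact hind.affineIndependent.finrank_vectorSpan hcard

/-- Theorem (dimension of `P_{n,K}`): for `n ≥ 5`,
(i) `dim P_{n,2} = |E| + n - 4`;
(ii) `dim P_{n,K} = |E| + n - 3` (full dimension) for `3 ≤ K ≤ n-2`;
(iii) `dim P_{n,n-1} = |E| - 1`; where `|E| = n(n-1)/2`. -/
theorem dim_PolyP (n K : ℕ) (hn : 5 ≤ n) (hK1 : 2 ≤ K) (hK2 : K ≤ n - 1) :
    (K = 2 → adim (PolyP n K) = n * (n - 1) / 2 + n - 4) ∧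
    (3 ≤ K → K ≤ n - 2 → adim (PolyP n K) = n * (n - 1) / 2 + n - 3) ∧
    (K = n - 1 → adim (PolyP n K) = n * (n - 1) / 2 - 1) := by
  refine ⟨?_, fun h3 hKn => ?_, ?_⟩
  · rintro rfl
    have h := adim_PolyP_add_finrank_constForms n 2
    rw [finrank_constForms_two hn] at h
    omega
  · have h := adim_PolyP_add_finrank_constForms n K
    rw [constForms_eq_bot hn h3 hKn, finrank_bot] at h
    omega
  · rintro rfl
    exact adim_PolyP_sub_one (by omega)
end

section
/- Let n ≥ 5 and 3 ≤ K ≤ n−2, and let v ∈ {4,…,n}. The inequality x_v ≥ 0 is facet-defining for P_{n,K} if and only if K ≠ n−2. -/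
namespace KPartition

open Finset

variable {n K : ℕ}

/-- The partition of `{1,…,n}` into the fibres of a labelling with exactly `K` labels. -/
def ofLabel (c : ℕ → ℕ) (h : ((Icc 1 n).image c).card = K) : KPartition n K where
  parts := ((Icc 1 n).image c).image fun l => (Icc 1 n).filter fun x => c x = l
  card_parts := by
    rw [card_image_of_injOn, h]
    intro l hl m _ hlm
    obtain ⟨x, hx, rfl⟩ := mem_image.1 hl
    have hx' : x ∈ (Icc 1 n).filter fun y => c y = c x := mem_filter.2 ⟨hx, rfl⟩
    exact (mem_filter.1 ((congrArg (x ∈ ·) hlm).mp hx')).2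
  parts_nonempty := by
    intro C hC
    simp only [mem_image] at hC
    obtain ⟨_, ⟨x, hx, rfl⟩, rfl⟩ := hC
    exact ⟨x, mem_filter.2 ⟨hx, rfl⟩⟩
  parts_disjoint := by
    intro C hC D hD hCD
    simp only [mem_image] at hC hD
    obtain ⟨l, -, rfl⟩ := hC
    obtain ⟨m, -, rfl⟩ := hD
    rw [disjoint_left]
    intro x hx hx'
    exact hCD (by rw [← (mem_filter.1 hx).2, (mem_filter.1 hx').2])
  parts_cover := by
    ext x
    simp only [mem_sup, id, mem_image]
    constructor
    · rintro ⟨_, ⟨_, -, rfl⟩, hx⟩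
      exact (mem_filter.1 hx).1
    · exact fun hx => ⟨_, ⟨_, ⟨x, hx, rfl⟩, rfl⟩, mem_filter.2 ⟨hx, rfl⟩⟩

lemma mem_Icc_of_mem (π : KPartition n K) {C : Finset ℕ} (hC : C ∈ π.parts) {x : ℕ}
    (hx : x ∈ C) : x ∈ Icc 1 n := by
  rw [← π.parts_cover]
  exact mem_sup.2 ⟨C, hC, hx⟩

lemma exists_mem_s2 (π : KPartition n K) {x : ℕ} (hx : x ∈ Icc 1 n) : ∃ C ∈ π.parts, x ∈ C := by
  rw [← π.parts_cover] at hx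
  simpa using mem_sup.1 hx

instance : Finite (KPartition n K) := by
  refine Finite.of_injective
    (fun π => (⟨π.parts, ?_⟩ : {P // P ∈ (Icc 1 n).powerset.powerset})) ?_
  · exact mem_powerset.2 fun C hC => mem_powerset.2 fun x hx => π.mem_Icc_of_mem hC hx
  · rintro ⟨P, _, _, _, _⟩ ⟨Q, _, _, _, _⟩ h
    simpa using h

open Classical in
/-- The characteristic vector of the partition into the fibres of `c`. -/
noncomputable def labelVec (n : ℕ) (c : ℕ → ℕ) : GPoint :=
  ⟨fun e => if e.1 ∈ Icc 1 n ∧ e.2 ∈ Icc 1 n ∧ c e.1 = c e.2 then 1 else 0,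
    fun x => if 4 ≤ x ∧ x ∈ Icc 1 n ∧ ∀ y ∈ Icc 1 n, c y = c x → x ≤ y then 1 else 0⟩

lemma labelVec_rep_eq_ite {c : ℕ → ℕ} {x : ℕ} {P : Prop} [Decidable P]
    (h : (4 ≤ x ∧ x ∈ Icc 1 n ∧ ∀ y ∈ Icc 1 n, c y = c x → x ≤ y) ↔ P) :
    (labelVec n c).2 x = if P then 1 else 0 := by
  simp only [labelVec, h]

lemma charVec_ofLabel (c : ℕ → ℕ) (h : ((Icc 1 n).image c).card = K) :
    charVec n K (ofLabel c h) = labelVec n c := by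
  classical
  refine Prod.ext ?_ ?_
  · funext e
    refine if_congr ?_ rfl rfl
    simp only [ofLabel, mem_image, exists_exists_and_eq_and, mem_filter]
    constructor
    · rintro ⟨x, hx, ⟨h1, h2⟩, h3, h4⟩
      exact ⟨h1, h3, h2.trans h4.symm⟩
    · rintro ⟨h1, h2, h3⟩
      exact ⟨_, h1, ⟨h1, rfl⟩, h2, h3.symm⟩
  · funext x
    simp only [charVec]
    symm
    refine labelVec_rep_eq_ite (Iff.symm ?_)
    simp only [ofLabel, mem_image, exists_exists_and_eq_and, mem_filter]
    refine and_congr_right fun _ => ⟨?_, ?_⟩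
    · rintro ⟨y, hy, ⟨h1, h2⟩, h3⟩
      exact ⟨h1, fun z hz hzx => h3 z ⟨hz, hzx.trans h2⟩⟩
    · rintro ⟨h1, h2⟩
      exact ⟨x, h1, ⟨h1, rfl⟩, fun z hz => h2 z hz.1 hz.2⟩

/-- The labelling fixing the elements of `M`, sending `a` to `i`, `b` to `j` and every other
element to `p`. -/
def lab (M : Finset ℕ) (p a b i j x : ℕ) : ℕ :=
  if x = a then i else if x = b then j else if x ∈ M then x else p

lemma image_lab {M : Finset ℕ} {p a b i j : ℕ} (hM : M ⊆ Icc 1 n) (hp : p ∈ M) (ha : a ∉ M)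
    (hb : b ∉ M) (hab : a ≠ b) (haI : a ∈ Icc 1 n) (hbI : b ∈ Icc 1 n) :
    (Icc 1 n).image (lab M p a b i j) = insert i (insert j M) := by
  ext l
  simp only [mem_image, mem_insert, lab]
  constructor
  · rintro ⟨x, hx, rfl⟩
    grind
  · rintro (rfl | rfl | hl)
    · exact ⟨a, haI, by simp⟩
    · exact ⟨b, hbI, by simp [hab.symm]⟩
    · exact ⟨l, hM hl, by grind⟩

/-- The edge direction, with both orientations of the edge `xy`. -/
noncomputable def edgeVec (x y : ℕ) : GPoint := (Pi.single (x, y) 1 + Pi.single (y, x) 1, 0)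

/-- The representative direction. -/
noncomputable def repVec (x : ℕ) : GPoint := (0, Pi.single x 1)

/-- The second difference of the characteristic vector when `a` and `b` move independently
between the clusters of `p` and `q`. -/
lemma labelVec_second_difference_fst {M : Finset ℕ} {p q a b : ℕ} (hpq : p ≠ q) (hab : a ≠ b)
    (haI : a ∈ Icc 1 n) (hbI : b ∈ Icc 1 n) :
    ((labelVec n (lab M p a b p p) - labelVec n (lab M p a b p q))
      - (labelVec n (lab M p a b q p) - labelVec n (lab M p a b q q))).1
      = ((2 : ℝ) • edgeVec a b).1 := by
  funext ⟨x, y⟩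
  simp only [labelVec, edgeVec, Prod.fst_sub, Pi.sub_apply, Prod.smul_fst, Pi.smul_apply,
    Pi.add_apply, Pi.single_apply, Prod.mk.injEq, smul_eq_mul]
  by_cases hx : x ∈ Icc 1 n
  swap
  · have h1 : x ≠ a := by grind
    have h2 : x ≠ b := by grind
    simp [hx, h1, h2]
  by_cases hy : y ∈ Icc 1 n
  swap
  · have h1 : y ≠ a := by grind
    have h2 : y ≠ b := by grind
    simp [hy, h1, h2]
  simp only [hx, hy, true_and, lab]
  by_cases hxa : x = a <;> by_cases hxb : x = b <;> by_cases hya : y = a <;>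
    by_cases hyb : y = b <;> grind

lemma labelVec_lab_rep {M : Finset ℕ} {p q a b i j : ℕ} (hM : M ⊆ Icc 1 n) (hp : p ∈ M)
    (hq : q ∈ M) (hpq : p ≠ q) (ha : a ∉ M) (hb : b ∉ M) (hab : a ≠ b) (haI : a ∈ Icc 1 n)
    (hbI : b ∈ Icc 1 n) (hi : i = p ∨ i = q) (hj : j = p ∨ j = q) (hp4 : p < 4)
    (h4 : q < 4 ∨ (a < 4 ∧ b < 4)) (x : ℕ) :
    (labelVec n (lab M p a b i j)).2 x
      = if 4 ≤ x ∧ x ∈ M ∧ (x = q → i = p ∧ j = p) then 1 else 0 := by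
  refine labelVec_rep_eq_ite ⟨?_, ?_⟩
  · rintro ⟨hx4, hx, h⟩
    have h1 := h p (hM hp)
    have h2 := h q (hM hq)
    have h3 := h a haI
    have h5 := h b hbI
    simp only [lab] at h1 h2 h3 h5
    grind
  · rintro ⟨hx4, hx, h⟩
    refine ⟨hx4, hM hx, fun y hy => ?_⟩
    simp only [lab]
    grind

lemma labelVec_second_difference {M : Finset ℕ} {p q a b : ℕ} (hM : M ⊆ Icc 1 n) (hp : p ∈ M)
    (hq : q ∈ M) (hpq : p ≠ q) (ha : a ∉ M) (hb : b ∉ M) (hab : a ≠ b) (haI : a ∈ Icc 1 n)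
    (hbI : b ∈ Icc 1 n) (hp4 : p < 4) (h4 : q < 4 ∨ (a < 4 ∧ b < 4)) :
    (labelVec n (lab M p a b p p) - labelVec n (lab M p a b p q))
      - (labelVec n (lab M p a b q p) - labelVec n (lab M p a b q q))
      = (2 : ℝ) • edgeVec a b + if q < 4 then 0 else repVec q := by
  refine Prod.ext ?_ ?_
  · rw [labelVec_second_difference_fst hpq hab haI hbI]
    split_ifs <;> simp [repVec]
  · funext x
    simp only [Prod.snd_sub, Pi.sub_apply]
    rw [labelVec_lab_rep hM hp hq hpq ha hb hab haI hbI (.inl rfl) (.inl rfl) hp4 h4,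
      labelVec_lab_rep hM hp hq hpq ha hb hab haI hbI (.inl rfl) (.inr rfl) hp4 h4,
      labelVec_lab_rep hM hp hq hpq ha hb hab haI hbI (.inr rfl) (.inl rfl) hp4 h4,
      labelVec_lab_rep hM hp hq hpq ha hb hab haI hbI (.inr rfl) (.inr rfl) hp4 h4]
    split_ifs with h <;> simp [edgeVec, repVec, Pi.single_apply] <;> grind

/-- Making `b` a singleton and moving its companion `a` to the cluster of `q`. -/
lemma labelVec_difference {M : Finset ℕ} {p q a b : ℕ} (hM : M ⊆ Icc 1 n) (hp : p ∈ M)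
    (hq : q ∈ M) (hpq : p ≠ q) (ha : a ∉ M) (hb : b ∉ M) (haI : a ∈ Icc 1 n)
    (hbI : b ∈ Icc 1 n) (hp4 : p < 4) (hq4 : q < 4) (ha4 : a < 4) (hb4 : 4 ≤ b) :
    labelVec n (lab M p a b q b) - labelVec n (lab M p a b a a)
      = edgeVec a q - edgeVec a b + repVec b := by
  have hab : a ≠ b := by omega
  refine Prod.ext ?_ ?_
  · funext ⟨x, y⟩
    simp only [labelVec, edgeVec, repVec, Prod.fst_sub, Prod.fst_add, Pi.sub_apply,
      Pi.add_apply, Pi.zero_apply, Pi.single_apply, Prod.mk.injEq]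
    by_cases hx : x ∈ Icc 1 n
    swap
    · have h1 : x ≠ a := by grind
      have h2 : x ≠ b := by grind
      have h3 : x ≠ q := by grind
      simp [hx, h1, h2, h3]
    by_cases hy : y ∈ Icc 1 n
    swap
    · have h1 : y ≠ a := by grind
      have h2 : y ≠ b := by grind
      have h3 : y ≠ q := by grind
      simp [hy, h1, h2, h3]
    simp only [hx, hy, true_and, lab]
    by_cases hxa : x = a <;> by_cases hxb : x = b <;> by_cases hya : y = a <;>
      by_cases hyb : y = b <;> grind
  · funext x
    have h1 : (labelVec n (lab M p a b q b)).2 x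
        = if 4 ≤ x ∧ (x ∈ M ∨ x = b) then 1 else 0 := by
      refine labelVec_rep_eq_ite ⟨?_, ?_⟩
      · rintro ⟨hx4, hx, h⟩
        have h1 := h p (hM hp)
        simp only [lab] at h1
        grind
      · rintro ⟨hx4, hx⟩
        refine ⟨hx4, by grind, fun y hy => ?_⟩
        simp only [lab]
        grind
    have h2 : (labelVec n (lab M p a b a a)).2 x = if 4 ≤ x ∧ x ∈ M then 1 else 0 := by
      refine labelVec_rep_eq_ite ⟨?_, ?_⟩
      · rintro ⟨hx4, hx, h⟩
        have h1 := h p (hM hp)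
        have h3 := h a haI
        simp only [lab] at h1 h3
        grind
      · rintro ⟨hx4, hx⟩
        refine ⟨hx4, by grind, fun y hy => ?_⟩
        simp only [lab]
        grind
    simp only [Prod.snd_sub, Prod.snd_add, Pi.sub_apply, Pi.add_apply, h1, h2, edgeVec, repVec,
      Pi.single_apply, Pi.zero_apply]
    grind

/-- The characteristic vectors of all `K`-partitions. -/
def vertices (n K : ℕ) : Set GPoint := {x | ∃ π : KPartition n K, x = charVec n K π}

/-- The face of `P_{n,K}` on which the representative component of `v` vanishes. -/
def repFace (n K v : ℕ) : Set GPoint := {x | x ∈ PolyP n K ∧ x.2 v = 0}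

/-- The representative component of `v` as a linear form. -/
def repForm (v : ℕ) : GPoint →ₗ[ℝ] ℝ := LinearMap.proj v ∘ₗ LinearMap.snd ℝ _ _

lemma repForm_apply (v : ℕ) (x : GPoint) : repForm v x = x.2 v := rfl

lemma vertices_subset : vertices n K ⊆ PolyP n K := subset_convexHull ℝ _

lemma finite_vertices : (vertices n K).Finite := by
  have : vertices n K = Set.range (charVec n K) := by
    ext x
    simp [vertices, eq_comm]
  rw [this]
  exact Set.finite_range _

lemma adim_eq_finrank (s : Set GPoint) : adim s = Module.finrank ℝ (vectorSpan ℝ s) := by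
  rw [adim, direction_affineSpan]

lemma vectorSpan_polyP : vectorSpan ℝ (PolyP n K) = vectorSpan ℝ (vertices n K) := by
  rw [← direction_affineSpan, PolyP, affineSpan_convexHull, direction_affineSpan]
  rfl

lemma charVec_rep_eq (π : KPartition n K) (v : ℕ) :
    (charVec n K π).2 v = 0 ∨ (charVec n K π).2 v = 1 := by
  simp only [charVec]
  split_ifs <;> simp

lemma rep_nonneg (v : ℕ) : ∀ x ∈ PolyP n K, 0 ≤ x.2 v := by
  have h : PolyP n K ⊆ {x | 0 ≤ repForm v x} := by
    refine convexHull_min ?_ (convex_halfSpace_ge (repForm v).isLinear 0)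
    rintro _ ⟨π, rfl⟩
    show 0 ≤ (charVec n K π).2 v
    rcases charVec_rep_eq π v with h | h <;> simp [h]
  exact h

/-- If the representative component of `v` is not constant on the partitions, `x_v ≥ 0` is
facet-defining exactly when the directions of `P_{n,K}` that fix `x_v` are directions of the
face. -/
lemma isFacetGe_rep_iff {v : ℕ} {y z : GPoint} (hy : y ∈ vertices n K) (hz : z ∈ vertices n K)
    (hyv : y.2 v = 0) (hzv : z.2 v = 1) :
    IsFacetGe n K (fun x => x.2 v) 0 ↔
      vectorSpan ℝ (vertices n K) ⊓ LinearMap.ker (repForm v) ≤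
        vectorSpan ℝ (repFace n K v) := by
  set D := vectorSpan ℝ (vertices n K) with hD
  set W := vectorSpan ℝ (repFace n K v) with hW
  have hfin : FiniteDimensional ℝ D :=
    finiteDimensional_vectorSpan_of_finite ℝ finite_vertices
  have hWD : W ≤ D ⊓ LinearMap.ker (repForm v) := by
    refine le_inf ?_ ?_
    · rw [hD, ← vectorSpan_polyP]
      exact vectorSpan_mono ℝ fun x hx => hx.1
    · rw [hW, vectorSpan_def, Submodule.span_le]
      rintro _ ⟨a, ha, b, hb, rfl⟩
      have h1 : a.2 v = 0 := ha.2
      have h2 : b.2 v = 0 := hb.2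
      simp [repForm_apply, h1, h2]
  have hne : (repForm v).domRestrict D ≠ 0 := by
    intro h
    have h1 : z - y ∈ D := vsub_mem_vectorSpan ℝ hz hy
    have h2 := LinearMap.congr_fun h ⟨z - y, h1⟩
    simp [repForm_apply, hyv, hzv] at h2
  have hker : Module.finrank ℝ (D ⊓ LinearMap.ker (repForm v) : Submodule ℝ GPoint) + 1
      = Module.finrank ℝ D := by
    rw [← Module.Dual.finrank_ker_add_one_of_ne_zero hne, LinearMap.ker_domRestrict,
      ← Submodule.finrank_map_subtype_eq, Submodule.map_comap_subtype]
  have hadim : adim {x | x ∈ PolyP n K ∧ x.2 v = 0} = Module.finrank ℝ W :=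
    adim_eq_finrank _
  rw [IsFacetGe, hadim, adim_eq_finrank, vectorSpan_polyP, ← hD, ← hker]
  constructor
  · rintro ⟨-, h⟩
    exact (Submodule.eq_of_le_of_finrank_eq hWD (Nat.succ.inj h)).ge
  · exact fun h => ⟨rep_nonneg v, by rw [le_antisymm hWD h]⟩

lemma labelVec_mem_vertices {c : ℕ → ℕ} (h : ((Icc 1 n).image c).card = K) :
    labelVec n c ∈ vertices n K :=
  ⟨ofLabel c h, (charVec_ofLabel c h).symm⟩

/-- The direction space of `P_{n,K}` consists of vectors with symmetric edge part, vanishing on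
loops and outside the index range. -/
lemma mem_vectorSpan_vertices {d : GPoint} (hd : d ∈ vectorSpan ℝ (vertices n K)) :
    (∀ x y, d.1 (x, y) = d.1 (y, x)) ∧ (∀ x, d.1 (x, x) = 0) ∧
      (∀ x y, x ∉ Icc 1 n → d.1 (x, y) = 0) ∧ ∀ x ∉ Icc 4 n, d.2 x = 0 := by
  rw [vectorSpan_def] at hd
  induction hd using Submodule.span_induction with
  | mem d hd =>
    obtain ⟨_, ⟨π, rfl⟩, _, ⟨ρ, rfl⟩, rfl⟩ := hd
    refine ⟨fun x y => ?_, fun x => ?_, fun x y hx => ?_, fun x hx => ?_⟩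
    · simp only [charVec, vsub_eq_sub, Prod.fst_sub, Pi.sub_apply, and_comm (a := x ∈ _)]
    · have h (π : KPartition n K) : (∃ C ∈ π.parts, x ∈ C ∧ x ∈ C) ↔ x ∈ Icc 1 n :=
        ⟨fun ⟨C, hC, hx, _⟩ => π.mem_Icc_of_mem hC hx, fun hx => by
          simpa using π.exists_mem_s2 hx⟩
      simp only [charVec, vsub_eq_sub, Prod.fst_sub, Pi.sub_apply, h, sub_self]
    · have h (π : KPartition n K) : ¬ ∃ C ∈ π.parts, x ∈ C ∧ y ∈ C :=
        fun ⟨C, hC, hx', _⟩ => hx (π.mem_Icc_of_mem hC hx')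
      simp only [charVec, vsub_eq_sub, Prod.fst_sub, Pi.sub_apply, h, if_false, sub_self]
    · have h (π : KPartition n K) :
          ¬ (4 ≤ x ∧ ∃ C ∈ π.parts, x ∈ C ∧ ∀ w ∈ C, x ≤ w) :=
        fun ⟨hx4, C, hC, hx', _⟩ => hx <| mem_Icc.2
          ⟨hx4, (mem_Icc.1 (π.mem_Icc_of_mem hC hx')).2⟩
      simp only [charVec, vsub_eq_sub, Prod.snd_sub, Pi.sub_apply, h, if_false, sub_self]
  | zero => simp
  | add d e _ _ hd he =>
    obtain ⟨h1, h2, h3, h4⟩ := hd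
    obtain ⟨k1, k2, k3, k4⟩ := he
    refine ⟨fun x y => ?_, fun x => ?_, fun x y hx => ?_, fun x hx => ?_⟩
    · simp [h1 x y, k1 x y]
    · simp [h2 x, k2 x]
    · simp [h3 x y hx, k3 x y hx]
    · simp [h4 x hx, k4 x hx]
  | smul t d _ hd =>
    obtain ⟨h1, h2, h3, h4⟩ := hd
    refine ⟨fun x y => ?_, fun x => ?_, fun x y hx => ?_, fun x hx => ?_⟩
    · simp [h1 x y]
    · simp [h2 x]
    · simp [h3 x y hx]
    · simp [h4 x hx]

lemma eq_sum_edgeVec_add_sum_repVec {d : GPoint} (hsymm : ∀ x y, d.1 (x, y) = d.1 (y, x))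
    (hI : ∀ x y, x ∉ Icc 1 n → d.1 (x, y) = 0) (h4 : ∀ x ∉ Icc 4 n, d.2 x = 0) :
    d = (∑ x ∈ Icc 1 n, ∑ y ∈ Icc 1 n, (d.1 (x, y) / 2) • edgeVec x y)
      + ∑ x ∈ Icc 4 n, d.2 x • repVec x := by
  refine Prod.ext ?_ ?_
  · funext ⟨a, b⟩
    have h1 : ∑ x ∈ Icc 1 n, ∑ y ∈ Icc 1 n,
        (d.1 (x, y) / 2) * (if a = x ∧ b = y then 1 else 0) = d.1 (a, b) / 2 := by
      by_cases ha : a ∈ Icc 1 n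
      · by_cases hb : b ∈ Icc 1 n
        · simp [ite_and, ha, hb, - mem_Icc]
        · simp [ite_and, hb, hsymm a b, hI b a hb, - mem_Icc]
      · simp [ite_and, ha, hI a b ha, - mem_Icc]
    have h2 : ∑ x ∈ Icc 1 n, ∑ y ∈ Icc 1 n,
        (d.1 (x, y) / 2) * (if a = y ∧ b = x then 1 else 0) = d.1 (a, b) / 2 := by
      by_cases ha : a ∈ Icc 1 n
      · by_cases hb : b ∈ Icc 1 n
        · simp [ite_and, ha, hb, hsymm b a, - mem_Icc]
        · simp [ite_and, ha, hb, hsymm a b, hI b a hb, - mem_Icc]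
      · simp [ite_and, ha, hI a b ha, - mem_Icc]
    simp only [Prod.fst_add, Prod.fst_sum, Prod.smul_fst, edgeVec, repVec, Pi.add_apply,
      Finset.sum_apply, Pi.smul_apply, Pi.single_apply, Prod.mk.injEq, smul_eq_mul, mul_add,
      sum_add_distrib, h1, h2]
    simp
  · funext a
    simp only [Prod.snd_add, Prod.snd_sum, Prod.smul_snd, edgeVec, repVec, Pi.add_apply,
      Finset.sum_apply, Pi.smul_apply, Pi.single_apply, smul_eq_mul]
    by_cases ha : a ∈ Icc 4 n
    · simp [ha, - mem_Icc]
    · simp [ha, h4 a ha, - mem_Icc]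

/-- Twice the sum of the edge components over the edges avoiding `v`. -/
noncomputable def deletedForm (n v : ℕ) : GPoint →ₗ[ℝ] ℝ :=
  ∑ e ∈ ((Icc 1 n).erase v).offDiag, LinearMap.proj e ∘ₗ LinearMap.fst ℝ _ _

lemma deletedForm_apply (n v : ℕ) (x : GPoint) :
    deletedForm n v x = ∑ e ∈ ((Icc 1 n).erase v).offDiag, x.1 e := by
  simp [deletedForm]

/-- Deleting a non-representative `v` from a partition with `n - 2` clusters leaves `n - 2`
clusters on `n - 1` vertices, hence exactly one edge. -/
lemma deletedForm_charVec {v : ℕ} (hn : 2 ≤ n) (hKn : K = n - 2) (hv : v ∈ Icc 4 n)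
    (π : KPartition n K) (h : (charVec n K π).2 v = 0) :
    deletedForm n v (charVec n K π) = 2 := by
  classical
  have hv4 := (mem_Icc.1 hv).1
  have hvI : v ∈ Icc 1 n := mem_Icc.2 ⟨by omega, (mem_Icc.1 hv).2⟩
  have hpos : ∀ C ∈ π.parts, 1 ≤ (C.erase v).card := by
    intro C hC
    rw [Nat.one_le_iff_ne_zero, ← Nat.pos_iff_ne_zero, card_pos]
    by_cases hvC : v ∈ C
    · by_contra hemp
      rw [not_nonempty_iff_eq_empty, erase_eq_empty_iff] at hemp
      have hrep : 4 ≤ v ∧ ∃ C ∈ π.parts, v ∈ C ∧ ∀ w ∈ C, v ≤ w := by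
        refine ⟨hv4, C, hC, hvC, fun w hw => ?_⟩
        rcases hemp with rfl | rfl
        · simp at hw
        · exact (mem_singleton.1 hw).ge
      simp [charVec, hrep] at h
    · rw [erase_eq_of_notMem hvC]
      exact π.parts_nonempty C hC
  have hdisj : ∀ C ∈ π.parts, ∀ D ∈ π.parts, C ≠ D → Disjoint (C.erase v) (D.erase v) :=
    fun C hC D hD hCD => (π.parts_disjoint C hC D hD hCD).mono (erase_subset _ _)
      (erase_subset _ _)
  have hsum : ∑ C ∈ π.parts, (C.erase v).card = n - 1 := by
    rw [← card_biUnion hdisj]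
    have : π.parts.biUnion (fun C => C.erase v) = (Icc 1 n).erase v := by
      ext x
      rw [← π.parts_cover]
      simp only [mem_biUnion, mem_erase, mem_sup, id]
      grind
    rw [this, card_erase_of_mem hvI, Nat.card_Icc]
    rfl
  have hle : ∀ C ∈ π.parts, (C.erase v).card ≤ 2 := by
    intro C hC
    have h1 := add_sum_erase π.parts (fun C => (C.erase v).card) hC
    have h2 : (π.parts.erase C).card * 1 ≤ ∑ D ∈ π.parts.erase C, (D.erase v).card :=
      card_nsmul_le_sum _ _ _ fun D hD => hpos D (mem_of_mem_erase hD)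
    rw [card_erase_of_mem hC, π.card_parts] at h2
    omega
  have hoff : ((Icc 1 n).erase v).offDiag.filter (fun e => ∃ C ∈ π.parts, e.1 ∈ C ∧ e.2 ∈ C)
      = π.parts.biUnion fun C => (C.erase v).offDiag := by
    ext ⟨x, y⟩
    simp only [mem_filter, mem_offDiag, mem_erase, mem_biUnion]
    constructor
    · rintro ⟨⟨h1, h2, h3⟩, C, hC, h4, h5⟩
      exact ⟨C, hC, ⟨h1.1, h4⟩, ⟨h2.1, h5⟩, h3⟩
    · rintro ⟨C, hC, h1, h2, h3⟩
      exact ⟨⟨⟨h1.1, π.mem_Icc_of_mem hC h1.2⟩, ⟨h2.1, π.mem_Icc_of_mem hC h2.2⟩, h3⟩,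
        C, hC, h1.2, h2.2⟩
  have hcard : (π.parts.biUnion fun C => (C.erase v).offDiag).card = 2 := by
    rw [card_biUnion]
    · have h1 : ∑ C ∈ π.parts, ((C.erase v).offDiag.card + 2)
          = ∑ C ∈ π.parts, 2 * (C.erase v).card := by
        refine sum_congr rfl fun C hC => ?_
        have h1 := hpos C hC
        have h2 := hle C hC
        rw [offDiag_card]
        interval_cases (C.erase v).card <;> rfl
      rw [sum_add_distrib, ← mul_sum, hsum, sum_const, π.card_parts, smul_eq_mul] at h1
      have : 0 < K := by
        have : π.parts.Nonempty := by
          obtain ⟨C, hC, -⟩ := π.exists_mem_s2 hvI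
          exact ⟨C, hC⟩
        rw [← π.card_parts]
        exact this.card_pos
      omega
    · intro C hC D hD hCD
      rw [Function.onFun, disjoint_left]
      rintro ⟨x, y⟩ h1 h2
      exact disjoint_left.1 (hdisj C hC D hD hCD) (mem_offDiag.1 h1).1 (mem_offDiag.1 h2).1
  rw [deletedForm_apply]
  simp only [charVec]
  rw [sum_boole]
  rw [← hoff] at hcard
  exact_mod_cast hcard

lemma deletedForm_repFace {v : ℕ} (hn : 2 ≤ n) (hKn : K = n - 2) (hv : v ∈ Icc 4 n)
    {x : GPoint} (hx : x ∈ repFace n K v) : deletedForm n v x = 2 := by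
  set N : ℝ := (((Icc 1 n).erase v).offDiag.card : ℝ) with hN
  have hN0 : 0 ≤ N := Nat.cast_nonneg _
  have hbound (π : KPartition n K) :
      0 ≤ deletedForm n v (charVec n K π) ∧ deletedForm n v (charVec n K π) ≤ N := by
    rw [deletedForm_apply]
    constructor
    · refine sum_nonneg fun e _ => ?_
      simp only [charVec]
      split_ifs <;> simp
    · rw [hN, ← nsmul_one]
      refine sum_le_card_nsmul _ _ _ fun e _ => ?_
      simp only [charVec]
      split_ifs <;> simp
  have hle : PolyP n K ⊆ {x | (deletedForm n v - N • repForm v) x ≤ 2} := by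
    refine convexHull_min ?_ (convex_halfSpace_le (LinearMap.isLinear _) _)
    rintro _ ⟨π, rfl⟩
    have h1 := hbound π
    rcases charVec_rep_eq π v with h | h
    · simp [repForm_apply, h, deletedForm_charVec hn hKn hv π h]
    · simp only [Set.mem_ofPred_eq, LinearMap.sub_apply, LinearMap.smul_apply, repForm_apply, h,
        smul_eq_mul]
      linarith
  have hge : PolyP n K ⊆ {x | 2 ≤ (deletedForm n v + (2 : ℝ) • repForm v) x} := by
    refine convexHull_min ?_ (convex_halfSpace_ge (LinearMap.isLinear _) _)
    rintro _ ⟨π, rfl⟩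
    have h1 := hbound π
    rcases charVec_rep_eq π v with h | h
    · simp [repForm_apply, h, deletedForm_charVec hn hKn hv π h]
    · simp only [Set.mem_ofPred_eq, LinearMap.add_apply, LinearMap.smul_apply, repForm_apply, h,
        smul_eq_mul]
      linarith
  have h0 : x.2 v = 0 := hx.2
  have h1 := hle hx.1
  have h2 := hge hx.1
  simp only [Set.mem_ofPred_eq, LinearMap.add_apply, LinearMap.sub_apply, LinearMap.smul_apply,
    repForm_apply, h0, smul_zero] at h1 h2
  linarith

/-- Two labels extend to a label set of any admissible size that avoids a given set of at most
three vertices. -/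
lemma exists_labels {p q m : ℕ} {X : Finset ℕ} (hp : p ∈ Icc 1 n) (hq : q ∈ Icc 1 n)
    (hpX : p ∉ X) (hqX : q ∉ X) (hX : X.card ≤ 3) (hm : 2 ≤ m) (hmn : m ≤ n - 3) :
    ∃ M ⊆ Icc 1 n, p ∈ M ∧ q ∈ M ∧ Disjoint M X ∧ M.card = m := by
  have h1 : ({p, q} : Finset ℕ) ⊆ Icc 1 n \ X := by
    intro x hx
    simp only [mem_insert, mem_singleton] at hx
    rcases hx with rfl | rfl <;> exact mem_sdiff.2 ⟨by assumption, by assumption⟩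
  have h2 : m ≤ (Icc 1 n \ X).card := by
    have := le_card_sdiff X (Icc 1 n)
    rw [Nat.card_Icc] at this
    omega
  obtain ⟨M, hM1, hM2, hM3⟩ :=
    exists_subsuperset_card_eq h1 (card_le_two.trans hm) h2
  exact ⟨M, hM2.trans sdiff_subset, hM1 (by simp), hM1 (by simp),
    disjoint_of_subset_left hM2 sdiff_disjoint, hM3⟩

lemma card_image_lab {M : Finset ℕ} {p a b i j : ℕ} (hM : M ⊆ Icc 1 n) (hp : p ∈ M) (ha : a ∉ M)
    (hb : b ∉ M) (hab : a ≠ b) (haI : a ∈ Icc 1 n) (hbI : b ∈ Icc 1 n) (hi : i ∈ M)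
    (hj : j ∈ M) : ((Icc 1 n).image (lab M p a b i j)).card = M.card := by
  rw [image_lab hM hp ha hb hab haI hbI, insert_eq_of_mem (a := j) hj, insert_eq_of_mem hi]

lemma labelVec_sub_mem {c e : ℕ → ℕ} {v : ℕ} (hc : ((Icc 1 n).image c).card = K)
    (he : ((Icc 1 n).image e).card = K) (hcv : (labelVec n c).2 v = 0)
    (hev : (labelVec n e).2 v = 0) :
    labelVec n c - labelVec n e ∈ vectorSpan ℝ (repFace n K v) :=
  vsub_mem_vectorSpan ℝ ⟨vertices_subset (labelVec_mem_vertices hc), hcv⟩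
    ⟨vertices_subset (labelVec_mem_vertices he), hev⟩

/-- Some partition has `v` as a representative, and some other does not. -/
lemma exists_vertices_rep {v : ℕ} (hK1 : 3 ≤ K) (hK2 : K ≤ n - 2) (hv : v ∈ Icc 4 n) :
    (∃ y ∈ vertices n K, y.2 v = 0) ∧ ∃ z ∈ vertices n K, z.2 v = 1 := by
  have hv4 := (mem_Icc.1 hv).1
  have hvn := (mem_Icc.1 hv).2
  have key (b : ℕ) (hb : b ∈ Icc 3 n) (T : Finset ℕ) (hT : T ⊆ Icc 1 n \ {2, b})
      (hTK : T.card ≤ K) (h1T : 1 ∈ T) :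
      ∃ M ⊆ Icc 1 n \ {2, b}, T ⊆ M ∧ labelVec n (lab M 1 2 b 1 1) ∈ vertices n K ∧
        (labelVec n (lab M 1 2 b 1 1)).2 v = if v ∈ M then 1 else 0 := by
    have hb3 := (mem_Icc.1 hb).1
    have hbn := (mem_Icc.1 hb).2
    have hcard : K ≤ (Icc 1 n \ {2, b}).card := by
      have h1 := le_card_sdiff {2, b} (Icc 1 n)
      have h2 : ({2, b} : Finset ℕ).card ≤ 2 := card_le_two
      rw [Nat.card_Icc] at h1
      omega
    obtain ⟨M, hTM, hM, hMK⟩ := exists_subsuperset_card_eq hT hTK hcard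
    have hMI : M ⊆ Icc 1 n := hM.trans sdiff_subset
    have h1M := hTM h1T
    refine ⟨M, hM, hTM, labelVec_mem_vertices ?_, labelVec_rep_eq_ite ⟨?_, ?_⟩⟩
    · rw [card_image_lab hMI h1M (fun h => by simpa using hM h) (fun h => by simpa using hM h)
        (by omega) (by simp; omega) (by simp; omega) h1M h1M, hMK]
    · rintro ⟨-, hv, h⟩
      by_contra hvM
      have h2 := h 1 (hMI h1M)
      simp only [lab] at h2
      grind
    · intro hvM
      refine ⟨hv4, hMI hvM, fun y _ => ?_⟩
      have h2 := hM hvM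
      simp only [lab]
      grind
  constructor
  · obtain ⟨M, hM, -, h1, h2⟩ := key v (mem_Icc.2 ⟨by omega, hvn⟩) {1}
      (by intro x; simp; omega) (by simp; omega) (by simp)
    exact ⟨_, h1, by rw [h2, if_neg fun h => by simpa using hM h]⟩
  · obtain ⟨M, -, hM, h1, h2⟩ := key 3 (mem_Icc.2 ⟨by omega, by omega⟩) {1, v}
      (by intro x; simp; omega) (card_le_two.trans (by omega)) (by simp)
    exact ⟨_, h1, by rw [h2, if_pos (hM (by simp))]⟩

/-- Two vertices moving independently between two clusters of a partition in which `v` is never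
a representative. -/
lemma edgeVec_add_mem {M : Finset ℕ} {v p q a b : ℕ} (hM : M ⊆ Icc 1 n) (hMK : M.card = K)
    (hp : p ∈ M) (hq : q ∈ M) (hpq : p ≠ q) (ha : a ∉ M) (hb : b ∉ M) (hab : a ≠ b)
    (haI : a ∈ Icc 1 n) (hbI : b ∈ Icc 1 n) (hp4 : p < 4) (h4 : q < 4 ∨ (a < 4 ∧ b < 4))
    (hvM : v ∉ M) :
    (2 : ℝ) • edgeVec a b + (if q < 4 then 0 else repVec q) ∈
      vectorSpan ℝ (repFace n K v) := by
  have key (i j : ℕ) (hi : i = p ∨ i = q) (hj : j = p ∨ j = q) :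
      ((Icc 1 n).image (lab M p a b i j)).card = K ∧
        (labelVec n (lab M p a b i j)).2 v = 0 := by
    constructor
    · rw [card_image_lab hM hp ha hb hab haI hbI (by grind) (by grind), hMK]
    · rw [labelVec_lab_rep hM hp hq hpq ha hb hab haI hbI hi hj hp4 h4,
        if_neg fun h => hvM h.2.1]
  obtain ⟨h1, k1⟩ := key p p (.inl rfl) (.inl rfl)
  obtain ⟨h2, k2⟩ := key p q (.inl rfl) (.inr rfl)
  obtain ⟨h3, k3⟩ := key q p (.inr rfl) (.inl rfl)
  obtain ⟨h5, k5⟩ := key q q (.inr rfl) (.inr rfl)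
  rw [← labelVec_second_difference hM hp hq hpq ha hb hab haI hbI hp4 h4]
  exact Submodule.sub_mem _ (labelVec_sub_mem h1 h2 k1 k2) (labelVec_sub_mem h3 h5 k3 k5)

/-- Edge directions with at most one endpoint in `{1,2,3}` are directions of the face. -/
lemma edgeVec_mem {v a b : ℕ} (hK1 : 3 ≤ K) (hK3 : K ≤ n - 3) (hv : v ∈ Icc 4 n)
    (ha : a ∈ Icc 1 n) (hb : b ∈ Icc 1 n) (hab : a ≠ b) (h4 : ¬ (a < 4 ∧ b < 4)) :
    edgeVec a b ∈ vectorSpan ℝ (repFace n K v) := by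
  have hv4 := (mem_Icc.1 hv).1
  obtain ⟨p, q, hpq, hp, hq, hpX, hqX, hp4, hq4⟩ : ∃ p q, p ≠ q ∧ p ∈ Icc 1 n ∧ q ∈ Icc 1 n ∧
      p ∉ ({a, b, v} : Finset ℕ) ∧ q ∉ ({a, b, v} : Finset ℕ) ∧ p < 4 ∧ q < 4 := by
    simp only [mem_Icc, mem_insert, mem_singleton] at *
    by_cases h1 : a = 1 ∨ b = 1
    · exact ⟨2, 3, by omega⟩
    by_cases h2 : a = 2 ∨ b = 2
    · exact ⟨1, 3, by omega⟩
    · exact ⟨1, 2, by omega⟩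
  obtain ⟨M, hM, hpM, hqM, hdis, hMK⟩ :=
    exists_labels hp hq hpX hqX card_le_three (by omega) hK3
  have hX (x : ℕ) (hx : x ∈ ({a, b, v} : Finset ℕ)) : x ∉ M := disjoint_right.1 hdis hx
  have h := edgeVec_add_mem hM hMK hpM hqM hpq (hX a (by simp)) (hX b (by simp)) hab ha hb hp4
    (.inl hq4) (hX v (by simp))
  rw [if_pos hq4, add_zero] at h
  exact (Submodule.smul_mem_iff _ two_ne_zero).1 h

lemma edgeVec_mem_and_repVec_mem {v p q a b : ℕ} (hK1 : 3 ≤ K) (hK3 : K ≤ n - 3)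
    (hv : v ∈ Icc 4 n) (hp : p ∈ Icc 1 3) (hq : q ∈ Icc 1 3) (ha : a ∈ Icc 1 3)
    (hpq : p ≠ q) (hpa : p ≠ a) (hqa : q ≠ a) (hb : b ∈ Icc 4 n) (hbv : b ≠ v) :
    edgeVec a q ∈ vectorSpan ℝ (repFace n K v) ∧
      repVec b ∈ vectorSpan ℝ (repFace n K v) := by
  set W := vectorSpan ℝ (repFace n K v)
  rw [mem_Icc] at hp hq ha hb
  have hv4 := (mem_Icc.1 hv).1
  have hIp : p ∈ Icc 1 n := mem_Icc.2 (by omega)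
  have hIq : q ∈ Icc 1 n := mem_Icc.2 (by omega)
  have hIa : a ∈ Icc 1 n := mem_Icc.2 (by omega)
  have hIb : b ∈ Icc 1 n := mem_Icc.2 (by omega)
  have h1 : (2 : ℝ) • edgeVec a q + repVec b ∈ W := by
    obtain ⟨M, hM, hpM, hbM, hdis, hMK⟩ := exists_labels (X := {a, q, v}) hIp hIb
      (by simp; omega) (by simp; omega) card_le_three (by omega) hK3
    have hX (x : ℕ) (hx : x ∈ ({a, q, v} : Finset ℕ)) : x ∉ M := disjoint_right.1 hdis hx
    have h := edgeVec_add_mem hM hMK hpM hbM (by omega) (hX a (by simp)) (hX q (by simp))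
      hqa.symm hIa hIq (by omega) (.inr (by omega)) (hX v (by simp))
    rwa [if_neg (by omega)] at h
  have h2 : edgeVec a q - edgeVec a b + repVec b ∈ W := by
    obtain ⟨M, hM, hpM, hqM, hdis, hMK⟩ := exists_labels (X := {a, b, v}) (m := K - 1) hIp hIq
      (by simp; omega) (by simp; omega) card_le_three (by omega) (by omega)
    have hX (x : ℕ) (hx : x ∈ ({a, b, v} : Finset ℕ)) : x ∉ M := disjoint_right.1 hdis hx
    have haM := hX a (by simp)
    have hbM := hX b (by simp)
    have hvM := hX v (by simp)
    rw [← labelVec_difference hM hpM hqM hpq haM hbM hIa hIb (by omega) (by omega) (by omega)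
      hb.1]
    refine labelVec_sub_mem ?_ ?_ ?_ ?_
    · rw [image_lab hM hpM haM hbM (by omega) hIa hIb, insert_eq_of_mem (by simp [hqM]),
        card_insert_of_notMem hbM, hMK]
      omega
    · rw [image_lab hM hpM haM hbM (by omega) hIa hIb, insert_eq_of_mem (by simp),
        card_insert_of_notMem haM, hMK]
      omega
    all_goals
      refine if_neg fun ⟨_, _, h⟩ => ?_
      have := h p hIp
      simp only [lab] at this
      grind
  have h3 : edgeVec a b ∈ W := edgeVec_mem hK1 hK3 hv hIa hIb (by omega) (by omega)
  have h4 : edgeVec a q ∈ W := by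
    have h := W.sub_mem h1 (W.add_mem h2 h3)
    have he : (2 : ℝ) • edgeVec a q + repVec b - (edgeVec a q - edgeVec a b + repVec b
      + edgeVec a b) = edgeVec a q := by
      rw [two_smul]
      abel
    rwa [he] at h
  exact ⟨h4, (W.add_mem_iff_right (W.smul_mem 2 h4)).1 h1⟩

/-- Every direction of `P_{n,K}` fixing `x_v` is a direction of the face when `K ≤ n - 3`. -/
lemma inf_ker_le {v : ℕ} (hK1 : 3 ≤ K) (hK3 : K ≤ n - 3) (hv : v ∈ Icc 4 n) :
    vectorSpan ℝ (vertices n K) ⊓ LinearMap.ker (repForm v) ≤ vectorSpan ℝ (repFace n K v) := by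
  rintro d ⟨hd, hdv⟩
  have hdv' : d.2 v = 0 := hdv
  have hvI := mem_Icc.1 hv
  obtain ⟨hsymm, hdiag, hI, h4⟩ := mem_vectorSpan_vertices hd
  obtain ⟨b, hb, hbv⟩ : ∃ b ∈ Icc 4 n, b ≠ v := by
    by_cases h : v = 4
    · exact ⟨5, mem_Icc.2 (by omega), by omega⟩
    · exact ⟨4, mem_Icc.2 (by omega), by omega⟩
  rw [eq_sum_edgeVec_add_sum_repVec hsymm hI h4]
  refine Submodule.add_mem _ (Submodule.sum_mem _ fun x hx => Submodule.sum_mem _ fun y hy => ?_)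
    (Submodule.sum_mem _ fun x hx => ?_)
  · by_cases hxy : x = y
    · subst hxy
      simp [hdiag]
    refine Submodule.smul_mem _ _ ?_
    by_cases hlow : x < 4 ∧ y < 4
    · rw [mem_Icc] at hx hy
      exact (edgeVec_mem_and_repVec_mem (p := 6 - x - y) hK1 hK3 hv (mem_Icc.2 (by omega))
        (mem_Icc.2 (by omega)) (mem_Icc.2 (by omega)) (by omega) (by omega) (Ne.symm hxy)
        hb hbv).1
    · exact edgeVec_mem hK1 hK3 hv hx hy hxy hlow
  · by_cases hxv : x = v
    · simp [hxv, hdv']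
    · exact Submodule.smul_mem _ _ (edgeVec_mem_and_repVec_mem (p := 1) (q := 2) (a := 3) hK1 hK3
        hv (by simp) (by simp) (by simp) (by simp) (by simp) (by simp) hx hxv).2

/-- For `K = n - 2` some direction of `P_{n,K}` fixing `x_v` changes `deletedForm`. -/
lemma not_inf_ker_le {v : ℕ} (hn : 5 ≤ n) (hKn : K = n - 2) (hv : v ∈ Icc 4 n) :
    ¬ vectorSpan ℝ (vertices n K) ⊓ LinearMap.ker (repForm v) ≤
      vectorSpan ℝ (repFace n K v) := by
  intro hle
  have hvI := mem_Icc.1 hv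
  obtain ⟨q, hq, hqv⟩ : ∃ q ∈ Icc 4 n, q ≠ v := by
    by_cases h : v = 4
    · exact ⟨5, mem_Icc.2 (by omega), by omega⟩
    · exact ⟨4, mem_Icc.2 (by omega), by omega⟩
  rw [mem_Icc] at hq
  set M := Icc 1 n \ {2, 3} with hMdef
  have hM : M ⊆ Icc 1 n := sdiff_subset
  have hMK : M.card = K := by
    rw [card_sdiff_of_subset (by intro x; simp; omega), Nat.card_Icc, hKn]
    rfl
  have h1M : 1 ∈ M := by simp [hMdef]; omega
  have hqM : q ∈ M := by simp [hMdef]; omega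
  have h2M : 2 ∉ M := by simp [hMdef]
  have h3M : 3 ∉ M := by simp [hMdef]
  have h2I : 2 ∈ Icc 1 n := mem_Icc.2 (by omega)
  have h3I : 3 ∈ Icc 1 n := mem_Icc.2 (by omega)
  have hvert (i j : ℕ) (hi : i ∈ M) (hj : j ∈ M) :
      labelVec n (lab M 1 2 3 i j) ∈ vertices n K :=
    labelVec_mem_vertices <| by
      rw [card_image_lab hM h1M h2M h3M (by norm_num) h2I h3I hi hj, hMK]
  have hd : (2 : ℝ) • edgeVec 2 3 + repVec q ∈ vectorSpan ℝ (vertices n K) := by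
    have h := labelVec_second_difference hM h1M hqM (by omega) h2M h3M (by norm_num) h2I h3I
      (by norm_num) (.inr (by norm_num))
    rw [if_neg (by omega)] at h
    rw [← h]
    exact Submodule.sub_mem _
      (vsub_mem_vectorSpan ℝ (hvert _ _ h1M h1M) (hvert _ _ h1M hqM))
      (vsub_mem_vectorSpan ℝ (hvert _ _ hqM h1M) (hvert _ _ hqM hqM))
  have hdW := hle ⟨hd, by simp [repForm_apply, edgeVec, repVec, hqv.symm]⟩
  have hW : vectorSpan ℝ (repFace n K v) ≤ LinearMap.ker (deletedForm n v) := by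
    rw [vectorSpan_def, Submodule.span_le]
    rintro _ ⟨x, hx, y, hy, rfl⟩
    simp [deletedForm_repFace (by omega) hKn hv hx, deletedForm_repFace (by omega) hKn hv hy]
  have h23 : (2, 3) ∈ ((Icc 1 n).erase v).offDiag := by simp; omega
  have h32 : (3, 2) ∈ ((Icc 1 n).erase v).offDiag := by simp; omega
  have h0 : deletedForm n v ((2 : ℝ) • edgeVec 2 3 + repVec q) = 0 := hW hdW
  have hrep : deletedForm n v (repVec q) = 0 := by simp [deletedForm_apply, repVec]
  have hedge : deletedForm n v (edgeVec 2 3) = 2 := by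
    simp only [deletedForm_apply, edgeVec, Pi.add_apply, Pi.single_apply, sum_add_distrib,
      sum_ite_eq', h23, h32, if_true]
    norm_num
  rw [map_add, map_smul, hrep, hedge] at h0
  norm_num at h0

end KPartition

/-- For `n ≥ 5`, `3 ≤ K ≤ n-2` and `v ∈ {4,…,n}`, the inequality `x_v ≥ 0` is facet-defining
for `P_{n,K}` iff `K ≠ n-2`. -/
theorem rep_nonneg_facet (n K v : ℕ) (hn : 5 ≤ n) (hK1 : 3 ≤ K) (hK2 : K ≤ n - 2)
    (hv : v ∈ Finset.Icc 4 n) :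
    IsFacetGe n K (fun x => x.2 v) 0 ↔ K ≠ n - 2 := by
  obtain ⟨⟨y, hy, hyv⟩, z, hz, hzv⟩ := KPartition.exists_vertices_rep hK1 hK2 hv
  rw [KPartition.isFacetGe_rep_iff hy hz hyv hzv]
  constructor
  · rintro h rfl
    exact KPartition.not_inf_ker_le hn rfl hv h
  · exact fun h => KPartition.inf_ker_le hK1 (by omega) hv
end
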